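/- For every integer n ≥ 1 there exists a constant C_n > 0 such that the following holds. Let (u,P) be a smooth solution of the incompressible Navier–Stokes equations on Q_{1/2} = (−1/4,0) × B_{1/2} satisfying |u(t,x)| ≤ 1 for all (t,x) ∈ Q_{1/2} and ∫_{−1/4}^0 ∫_{B_{1/2}} |∇P(t,x)| dx dt ≤ 1. Then |∇ⁿu(t,x)| ≤ C_n for all (t,x) ∈ Q_{1/4} = (−1/16,0) × B_{1/4}, where ∇ⁿu(t,x) denotes the n-th iterated spatial Fréchet derivative of u(t,·) at x with its operator norm. -/

import Mathlib

open MeasureTheory Set Metric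
open scoped ENNReal NNReal

noncomputable section

/-- `ℝ³` with the Euclidean norm. -/
abbrev E3 := EuclideanSpace ℝ (Fin 3)

/-- Spatial partial derivative `∂ⱼ f` of a scalar function. -/
def pd (f : E3 → ℝ) (j : Fin 3) (x : E3) : ℝ :=
  fderiv ℝ f x (EuclideanSpace.single j 1)

/-- `|∇f|² = Σ_{i,j} |∂ⱼ fᵢ|²`. -/
def gradSq (f : E3 → E3) (x : E3) : ℝ :=
  ∑ i, ∑ j, (pd (fun y => f y i) j x) ^ 2

/-- `(u,P)` is a smooth solution of the incompressible Navier–Stokes equations on the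
open set `U ⊆ ℝ × ℝ³`: `u` and `P` are infinitely differentiable on `U`, and on `U` one has
`∂ₜuᵢ + Σⱼ uⱼ ∂ⱼuᵢ + ∂ᵢP − Δuᵢ = 0` and `div u = 0`. -/
def IsNSSolution (u : ℝ → E3 → E3) (P : ℝ → E3 → ℝ) (U : Set (ℝ × E3)) : Prop :=
  ContDiffOn ℝ (⊤ : ℕ∞) (fun q : ℝ × E3 => u q.1 q.2) U ∧
  ContDiffOn ℝ (⊤ : ℕ∞) (fun q : ℝ × E3 => P q.1 q.2) U ∧
  (∀ q ∈ U, ∀ i : Fin 3,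
    deriv (fun s => u s q.2 i) q.1
      + (∑ j, u q.1 q.2 j * pd (fun y => u q.1 y i) j q.2)
      + pd (fun y => P q.1 y) i q.2
      - ∑ j, pd (pd (fun y => u q.1 y i) j) j q.2 = 0) ∧
  (∀ q ∈ U, ∑ i, pd (fun y => u q.1 y i) i q.2 = 0)

namespace NSBootstrap

open scoped ContDiff

/-- Space-time. -/
abbrev ST := ℝ × E3

section Calculus

variable {E : Type*} [NormedAddCommGroup E] [NormedSpace ℝ E]

/-- The derivative of `f` in the direction `a`. -/
def dd (a : E) (f : E → ℝ) (x : E) : ℝ := fderiv ℝ f x a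

lemma smooth_dd {f : E → ℝ} (hf : ContDiff ℝ ∞ f) (a : E) : ContDiff ℝ ∞ (dd a f) :=
  (hf.fderiv_right (m := ∞) (by simp)).clm_apply contDiff_const

lemma diff_of_smooth {f : E → ℝ} (hf : ContDiff ℝ ∞ f) : Differentiable ℝ f :=
  hf.differentiable (by simp)

lemma dd_comm {f : E → ℝ} (hf : ContDiff ℝ ∞ f) (a b : E) :
    dd a (dd b f) = dd b (dd a f) := by
  have key : ∀ (a b x : E), dd a (dd b f) x = fderiv ℝ (fderiv ℝ f) x a b := by
    intro a b x
    have h : DifferentiableAt ℝ (fderiv ℝ f) x :=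
      ((hf.fderiv_right (m := ∞) (by simp)).differentiable (by simp)) x
    simp only [dd]
    change fderiv ℝ (fun y => fderiv ℝ f y b) x a = _
    rw [fderiv_clm_apply h (differentiableAt_const b)]
    simp
  ext x
  rw [key, key]
  have h2 : (2 : WithTop ℕ∞) ≤ ((⊤ : ℕ∞) : WithTop ℕ∞) :=
    WithTop.coe_le_coe.2 (le_top : (2 : ℕ∞) ≤ ⊤)
  exact (hf.contDiffAt.isSymmSndFDerivAt (by simpa using h2)) a b

lemma dd_add {f g : E → ℝ} (hf : ContDiff ℝ ∞ f) (hg : ContDiff ℝ ∞ g) (a : E) :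
    dd a (fun x => f x + g x) = fun x => dd a f x + dd a g x := by
  ext x
  simp only [dd]
  rw [fderiv_fun_add (diff_of_smooth hf x) (diff_of_smooth hg x)]
  rfl

lemma dd_sub {f g : E → ℝ} (hf : ContDiff ℝ ∞ f) (hg : ContDiff ℝ ∞ g) (a : E) :
    dd a (fun x => f x - g x) = fun x => dd a f x - dd a g x := by
  ext x
  simp only [dd]
  rw [fderiv_fun_sub (diff_of_smooth hf x) (diff_of_smooth hg x)]
  rfl

lemma dd_neg (f : E → ℝ) (a : E) : dd a (fun x => - f x) = fun x => - dd a f x := by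
  ext x
  simp [dd, fderiv_fun_neg]

lemma dd_mul {f g : E → ℝ} (hf : ContDiff ℝ ∞ f) (hg : ContDiff ℝ ∞ g) (a : E) :
    dd a (fun x => f x * g x) = fun x => dd a f x * g x + f x * dd a g x := by
  ext x
  simp only [dd]
  rw [fderiv_fun_mul (diff_of_smooth hf x) (diff_of_smooth hg x)]
  simp
  ring

lemma dd_sum {ι : Type*} (s : Finset ι) {f : ι → E → ℝ} (hf : ∀ i, ContDiff ℝ ∞ (f i)) (a : E) :
    dd a (fun x => ∑ i ∈ s, f i x) = fun x => ∑ i ∈ s, dd a (f i) x := by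
  ext x
  simp only [dd]
  rw [fderiv_fun_sum (fun i _ => diff_of_smooth (hf i) x)]
  simp

@[simp] lemma dd_zero (a : E) : dd a (fun _ => (0 : ℝ)) = fun _ => 0 := by
  ext x; simp [dd]

end Calculus

/-- The spatial direction `eⱼ` in space-time. -/
def e (j : Fin 3) : ST := (0, EuclideanSpace.single j 1)

/-- The time direction in space-time. -/
def tt : ST := (1, 0)

/-- Iterated spatial partial derivatives. -/
def D : List (Fin 3) → (ST → ℝ) → ST → ℝ
  | [], f => f
  | j :: l, f => D l (dd (e j) f)

lemma smooth_D (l : List (Fin 3)) {f : ST → ℝ} (hf : ContDiff ℝ ∞ f) : ContDiff ℝ ∞ (D l f) := by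
  induction l generalizing f with
  | nil => exact hf
  | cons j l ih => exact ih (smooth_dd hf _)

lemma D_dd (l : List (Fin 3)) {f : ST → ℝ} (hf : ContDiff ℝ ∞ f) (a : ST) :
    D l (dd a f) = dd a (D l f) := by
  induction l generalizing f with
  | nil => rfl
  | cons j l ih =>
    simp only [D]
    rw [dd_comm hf, ih (smooth_dd hf _)]

lemma D_cons (l : List (Fin 3)) {f : ST → ℝ} (hf : ContDiff ℝ ∞ f) (j : Fin 3) :
    D (j :: l) f = dd (e j) (D l f) := D_dd l hf (e j)

lemma D_add (l : List (Fin 3)) {f g : ST → ℝ} (hf : ContDiff ℝ ∞ f) (hg : ContDiff ℝ ∞ g) :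
    D l (fun q => f q + g q) = fun q => D l f q + D l g q := by
  induction l generalizing f g with
  | nil => rfl
  | cons j l ih => simp only [D]; rw [dd_add hf hg, ih (smooth_dd hf _) (smooth_dd hg _)]

lemma D_sub (l : List (Fin 3)) {f g : ST → ℝ} (hf : ContDiff ℝ ∞ f) (hg : ContDiff ℝ ∞ g) :
    D l (fun q => f q - g q) = fun q => D l f q - D l g q := by
  induction l generalizing f g with
  | nil => rfl
  | cons j l ih => simp only [D]; rw [dd_sub hf hg, ih (smooth_dd hf _) (smooth_dd hg _)]

@[simp] lemma D_zero (l : List (Fin 3)) : D l (fun _ => (0 : ℝ)) = fun _ => 0 := by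
  induction l with
  | nil => rfl
  | cons j l ih => simp only [D, dd_zero, ih]

lemma D_sum (l : List (Fin 3)) {ι : Type*} (s : Finset ι) {f : ι → ST → ℝ}
    (hf : ∀ i, ContDiff ℝ ∞ (f i)) :
    D l (fun q => ∑ i ∈ s, f i q) = fun q => ∑ i ∈ s, D l (f i) q := by
  induction l generalizing f with
  | nil => rfl
  | cons j l ih => simp only [D]; rw [dd_sum s hf, ih (fun i => smooth_dd (hf i) _)]

lemma hasFDerivAt_slice {f : ST → ℝ} (hf : ContDiff ℝ ∞ f) (t : ℝ) (x : E3) :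
    HasFDerivAt (fun y : E3 => f (t, y))
      ((fderiv ℝ f (t, x)).comp (ContinuousLinearMap.inr ℝ ℝ E3)) x :=
  ((diff_of_smooth hf (t, x)).hasFDerivAt).comp x (hasFDerivAt_prodMk_right t x)

lemma dd_slice {f : ST → ℝ} (hf : ContDiff ℝ ∞ f) (t : ℝ) (x : E3) (j : Fin 3) :
    dd (EuclideanSpace.single j 1) (fun y : E3 => f (t, y)) x = dd (e j) f (t, x) := by
  simp [dd, (hasFDerivAt_slice hf t x).fderiv, e]

lemma hasDerivAt_time {f : ST → ℝ} (hf : ContDiff ℝ ∞ f) (t : ℝ) (x : E3) :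
    HasDerivAt (fun s : ℝ => f (s, x)) (dd tt f (t, x)) t := by
  have := (((diff_of_smooth hf (t, x)).hasFDerivAt).comp (𝕜 := ℝ) t
    (hasFDerivAt_prodMk_left t x)).hasDerivAt
  simp only [ContinuousLinearMap.comp_apply, ContinuousLinearMap.inl_apply] at this
  exact this

lemma dd_congr {f g : ST → ℝ} (hf : ContDiff ℝ ∞ f) (hg : ContDiff ℝ ∞ g) {t : ℝ} {s : Set E3}
    (hs : IsOpen s) (h : ∀ x ∈ s, f (t, x) = g (t, x)) (j : Fin 3) :
    ∀ x ∈ s, dd (e j) f (t, x) = dd (e j) g (t, x) := by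
  intro x hx
  rw [← dd_slice hf, ← dd_slice hg]
  have : (fun y : E3 => f (t, y)) =ᶠ[nhds x] fun y => g (t, y) := by
    filter_upwards [hs.mem_nhds hx] with y hy using h y hy
  simp only [dd, this.fderiv_eq]

lemma D_congr (l : List (Fin 3)) {f g : ST → ℝ} (hf : ContDiff ℝ ∞ f) (hg : ContDiff ℝ ∞ g)
    {t : ℝ} {s : Set E3} (hs : IsOpen s) (h : ∀ x ∈ s, f (t, x) = g (t, x)) :
    ∀ x ∈ s, D l f (t, x) = D l g (t, x) := by
  induction l generalizing f g with
  | nil => exact h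
  | cons j l ih => exact ih (smooth_dd hf _) (smooth_dd hg _) (dd_congr hf hg hs h j)

lemma continuous_slice {f : ST → ℝ} (hf : Continuous f) (t : ℝ) :
    Continuous fun x : E3 => f (t, x) := hf.comp (by fun_prop)

lemma integrableOn_ball {f : E3 → ℝ} (hf : Continuous f) (r : ℝ) :
    IntegrableOn f (ball 0 r) :=
  (hf.continuousOn.integrableOn_compact (isCompact_closedBall (0 : E3) r)).mono_set
    ball_subset_closedBall

lemma eq_zero_of_dd {f : ST → ℝ} (hf : ContDiff ℝ ∞ f) {t ρ : ℝ}
    (h : ∀ x, ρ ≤ ‖x‖ → f (t, x) = 0) (j : Fin 3) {x : E3} (hx : ρ < ‖x‖) :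
    dd (e j) f (t, x) = 0 := by
  have := dd_congr hf (g := fun _ => 0) contDiff_const (t := t) (s := {x | ρ < ‖x‖})
    (isOpen_lt continuous_const continuous_norm) (fun x hx => h x (le_of_lt hx)) j x hx
  simpa using this

lemma integral_dd_eq_zero {f : ST → ℝ} (hf : ContDiff ℝ ∞ f) {t ρ R : ℝ} (hρ : ρ < R)
    (h : ∀ x, ρ ≤ ‖x‖ → f (t, x) = 0) (j : Fin 3) :
    ∫ x in ball (0 : E3) R, dd (e j) f (t, x) = 0 := by
  rw [setIntegral_eq_integral_of_forall_compl_eq_zero]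
  · have hc : HasCompactSupport fun x : E3 => f (t, x) :=
      HasCompactSupport.intro (isCompact_closedBall (0 : E3) ρ) fun x hx => h x <| by
        simp at hx; exact hx.le
    have hc' : HasCompactSupport fun x : E3 => dd (e j) f (t, x) :=
      HasCompactSupport.intro (isCompact_closedBall (0 : E3) ρ) fun x hx =>
        eq_zero_of_dd hf h j <| by simpa using hx
    have hi := (continuous_slice hf.continuous t).integrable_of_hasCompactSupport hc (μ := volume)
    have hi' := (continuous_slice (smooth_dd hf (e j)).continuous t).integrable_of_hasCompactSupport
      hc' (μ := volume)
    have := integral_mul_fderiv_eq_neg_fderiv_mul_of_integrable (μ := (volume : Measure E3))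
      (f := fun _ => (1 : ℝ))
      (g := fun x : E3 => f (t, x)) (v := EuclideanSpace.single j 1) (by simp)
      (by
        simp only [one_mul]
        exact hi'.congr (.of_forall fun x => (dd_slice hf t x j).symm)) (by simpa using hi)
      (fun _ _ => differentiableAt_const _)
      (fun x _ => (hasFDerivAt_slice hf t x).differentiableAt)
    simp only [one_mul, fderiv_fun_const, Pi.zero_apply, zero_apply, zero_mul,
      integral_zero, neg_zero] at this
    rw [← this]
    exact integral_congr_ae (.of_forall fun x => (dd_slice hf t x j).symm)
  · intro x hx
    simp only [mem_ball, dist_zero_right, not_lt] at hx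
    exact eq_zero_of_dd hf h j (hρ.trans_le hx)

/-- `ψ` is a time-independent cutoff function between the balls of radii `r` and `R`, with
spatial derivatives bounded by `K`. -/
structure IsCutoff (r R K : ℝ) (ψ : ST → ℝ) : Prop where
  smooth : ContDiff ℝ ∞ ψ
  nonneg : ∀ q, 0 ≤ ψ q
  le_one : ∀ q, ψ q ≤ 1
  eq_one : ∀ t x, x ∈ ball (0 : E3) r → ψ (t, x) = 1
  eq_zero : ∀ t x, (r + R) / 2 ≤ ‖x‖ → ψ (t, x) = 0
  dd_le : ∀ j q, |dd (e j) ψ q| ≤ K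
  dd_dd_le : ∀ j q, |dd (e j) (dd (e j) ψ) q| ≤ K
  dd_time : ∀ q, dd tt ψ q = 0

lemma exists_cutoff {r R : ℝ} (hr : 0 < r) (hR : r < R) : ∃ ψ K, IsCutoff r R K ψ := by
  let b : ContDiffBump (0 : E3) := ⟨r, (r + R) / 2, hr, by linarith⟩
  have hbs : ContDiff ℝ ∞ b := b.contDiff
  have hd1 : ∀ j : Fin 3, ContDiff ℝ ∞ (dd (EuclideanSpace.single j (1 : ℝ)) b) := fun j =>
    smooth_dd hbs _
  have hs1 : ∀ j : Fin 3, HasCompactSupport (dd (EuclideanSpace.single j (1 : ℝ)) b) := fun j =>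
    b.hasCompactSupport.fderiv_apply ℝ _
  have hs2 : ∀ j : Fin 3, HasCompactSupport
      (dd (EuclideanSpace.single j (1 : ℝ)) (dd (EuclideanSpace.single j (1 : ℝ)) b)) := fun j =>
    (hs1 j).fderiv_apply ℝ _
  choose K hK using fun j => (hs1 j).exists_bound_of_continuous (hd1 j).continuous
  choose L hL using fun j => (hs2 j).exists_bound_of_continuous (smooth_dd (hd1 j) _).continuous
  have hK0 : ∀ j, 0 ≤ K j := fun j => (norm_nonneg _).trans (hK j 0)
  have hL0 : ∀ j, 0 ≤ L j := fun j => (norm_nonneg _).trans (hL j 0)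
  have hψ : ContDiff ℝ ∞ (fun q : ST => b q.2) := hbs.comp contDiff_snd
  have h1 : ∀ j, dd (e j) (fun q : ST => b q.2) =
      fun q => dd (EuclideanSpace.single j (1 : ℝ)) b q.2 := fun j => by
    ext ⟨t, x⟩
    rw [← dd_slice hψ]
  have h2 : ∀ j, dd (e j) (dd (e j) (fun q : ST => b q.2)) = fun q =>
      dd (EuclideanSpace.single j (1 : ℝ)) (dd (EuclideanSpace.single j (1 : ℝ)) b) q.2 := fun j => by
    ext ⟨t, x⟩
    rw [h1]
    exact (dd_slice ((hd1 j).comp contDiff_snd) t x j).symm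
  have hle : ∀ j, K j + L j ≤ ∑ j, (K j + L j) := fun j =>
    Finset.single_le_sum (f := fun j => K j + L j) (fun j _ => add_nonneg (hK0 j) (hL0 j))
      (Finset.mem_univ j)
  refine ⟨fun q => b q.2, ∑ j, (K j + L j), hψ, fun q => b.nonneg, fun q => b.le_one,
    fun t x hx => ?_, fun t x hx => ?_, fun j q => ?_, fun j q => ?_, fun q => ?_⟩
  · exact b.one_of_mem_closedBall (ball_subset_closedBall hx)
  · exact b.zero_of_le_dist (by simpa using hx)
  · rw [h1]
    exact (hK j q.2).trans (by linarith [hle j, hL0 j])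
  · rw [h2]
    exact (hL j q.2).trans (by linarith [hle j, hK0 j])
  · obtain ⟨t, x⟩ := q
    exact (hasDerivAt_time hψ t x).unique (hasDerivAt_const t (b x))

/-- The cylinder `[a, b] × B_r`. -/
abbrev cyl (a b r : ℝ) : Set ST := Icc a b ×ˢ ball (0 : E3) r

lemma integrableOn_cyl {f : ST → ℝ} (hf : Continuous f) (a b r : ℝ) :
    IntegrableOn f (cyl a b r) :=
  (hf.continuousOn.integrableOn_compact
    (isCompact_Icc.prod (isCompact_closedBall (0 : E3) r))).mono_set
    (prod_mono_right ball_subset_closedBall)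

lemma measurableSet_cyl (a b r : ℝ) : MeasurableSet (cyl a b r) :=
  measurableSet_Icc.prod measurableSet_ball

lemma integrable_cyl {f : ST → ℝ} (hf : Continuous f) (a b r : ℝ) :
    Integrable f ((volume.restrict (Icc a b)).prod (volume.restrict (ball (0 : E3) r))) := by
  rw [Measure.prod_restrict]
  exact integrableOn_cyl hf a b r

lemma integral_cyl {f : ST → ℝ} (hf : Continuous f) (a b r : ℝ) :
    ∫ q in cyl a b r, f q = ∫ t in Icc a b, ∫ x in ball (0 : E3) r, f (t, x) :=
  setIntegral_prod f (integrableOn_cyl hf a b r)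

lemma integrableOn_slice {f : ST → ℝ} (hf : Continuous f) (a b r : ℝ) :
    IntegrableOn (fun t => ∫ x in ball (0 : E3) r, f (t, x)) (Icc a b) :=
  (integrable_cyl hf a b r).integral_prod_left

lemma integral_cyl_swap {f : ST → ℝ} (hf : Continuous f) (a b r : ℝ) :
    ∫ q in cyl a b r, f q = ∫ x in ball (0 : E3) r, ∫ t in Icc a b, f (t, x) := by
  rw [integral_cyl hf]
  exact integral_integral_swap (f := fun t x => f (t, x)) (integrable_cyl hf a b r)

lemma integral_ball_mono {f g : E3 → ℝ} (hf : Continuous f) (hg : Continuous g) {r : ℝ}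
    (h : ∀ x ∈ ball (0 : E3) r, f x ≤ g x) :
    ∫ x in ball (0 : E3) r, f x ≤ ∫ x in ball (0 : E3) r, g x :=
  setIntegral_mono_on (integrableOn_ball hf r) (integrableOn_ball hg r) measurableSet_ball h

lemma integral_cyl_mono {f g : ST → ℝ} (hf : Continuous f) (hg : Continuous g) {a b r : ℝ}
    (h : ∀ q ∈ cyl a b r, f q ≤ g q) :
    ∫ q in cyl a b r, f q ≤ ∫ q in cyl a b r, g q :=
  setIntegral_mono_on (integrableOn_cyl hf a b r) (integrableOn_cyl hg a b r)
    (measurableSet_cyl a b r) h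

lemma integral_ball_mono_set {f : E3 → ℝ} (hf : Continuous f) (h0 : ∀ x, 0 ≤ f x) {r R : ℝ}
    (h : r ≤ R) : ∫ x in ball (0 : E3) r, f x ≤ ∫ x in ball (0 : E3) R, f x :=
  setIntegral_mono_set (integrableOn_ball hf R) (.of_forall h0)
    (ball_subset_ball h).eventuallyLE

lemma integral_cyl_mono_set {f : ST → ℝ} (hf : Continuous f) (h0 : ∀ x, 0 ≤ f x)
    {a b r a' b' r' : ℝ} (ha : a' ≤ a) (hb : b ≤ b') (hr : r ≤ r') :
    ∫ q in cyl a b r, f q ≤ ∫ q in cyl a' b' r', f q :=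
  setIntegral_mono_set (integrableOn_cyl hf a' b' r') (.of_forall h0)
    (prod_mono (Icc_subset_Icc ha hb) (ball_subset_ball hr)).eventuallyLE

lemma caccioppoli_pointwise (p p' w w' G a g K : ℝ) (h0 : 0 ≤ p) (h1 : p ≤ 1) (hK : |p'| ≤ K) :
    p ^ 2 * w * (a + g) - (((p' * p + p * p') * w + p * p * w') * (w' + G) + p * p * w * (a + g))
      ≤ - (1 / 2) * p ^ 2 * w' ^ 2 + 5 * K ^ 2 * w ^ 2 + 2 * G ^ 2 := by
  have e1 : p ^ 2 * w * (a + g) -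
      (((p' * p + p * p') * w + p * p * w') * (w' + G) + p * p * w * (a + g))
      = - (2 * (p' * w) + p * w') * (p * w' + p * G) := by ring
  have h2 : p' ^ 2 ≤ K ^ 2 := sq_le_sq' (by linarith [(abs_le.1 hK).1]) (abs_le.1 hK).2
  have h3 : p ^ 2 ≤ 1 := by nlinarith
  have h4 : (p' * w) ^ 2 ≤ K ^ 2 * w ^ 2 := by
    rw [mul_pow]; exact mul_le_mul_of_nonneg_right h2 (sq_nonneg w)
  have h5 : (p * G) ^ 2 ≤ G ^ 2 := by
    rw [mul_pow]; nlinarith [mul_le_mul_of_nonneg_right h3 (sq_nonneg G)]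
  rw [e1]
  nlinarith [sq_nonneg (p * w' + 4 * (p' * w)), sq_nonneg (p' * w + p * G),
    sq_nonneg (p * w' + 2 * (p * G))]

/-- Integration by parts against `ψ² w` on a time slice. -/
lemma caccioppoli_slice {r R K : ℝ} (hrR : r < R) {ψ : ST → ℝ} (hψ : IsCutoff r R K ψ)
    {w : ST → ℝ} {G : Fin 3 → ST → ℝ} (hw : ContDiff ℝ ∞ w) (hG : ∀ i, ContDiff ℝ ∞ (G i)) (t : ℝ) :
    ∫ x in ball (0 : E3) R,
        ψ (t, x) ^ 2 * w (t, x) * ∑ i, (dd (e i) (dd (e i) w) (t, x) + dd (e i) (G i) (t, x)) ≤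
      ∫ x in ball (0 : E3) R, (- (1 / 2) * ψ (t, x) ^ 2 * ∑ i, dd (e i) w (t, x) ^ 2
        + 15 * K ^ 2 * w (t, x) ^ 2 + 2 * ∑ i, G i (t, x) ^ 2) := by
  have hs := hψ.smooth
  have h1 := fun i => smooth_dd hw (e i)
  have h2 := fun i => smooth_dd (h1 i) (e i)
  have h3 := fun i => smooth_dd (hG i) (e i)
  have h4 := fun i => smooth_dd hs (e i)
  let H : Fin 3 → ST → ℝ := fun i q => ((ψ q * ψ q) * w q) * (dd (e i) w q + G i q)
  have hH : ∀ i, ContDiff ℝ ∞ (H i) := fun i => ((hs.mul hs).mul hw).mul ((h1 i).add (hG i))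
  have hdH : ∀ i, dd (e i) (H i) = fun q =>
      ((dd (e i) ψ q * ψ q + ψ q * dd (e i) ψ q) * w q + ψ q * ψ q * dd (e i) w q)
        * (dd (e i) w q + G i q)
      + ψ q * ψ q * w q * (dd (e i) (dd (e i) w) q + dd (e i) (G i) q) := by
    intro i
    simp only [H]
    rw [dd_mul ((hs.mul hs).mul hw) ((h1 i).add (hG i)), dd_mul (hs.mul hs) hw, dd_mul hs hs,
      dd_add (h1 i) (hG i)]
  have hint : ∀ i, ∫ x in ball (0 : E3) R, dd (e i) (H i) (t, x) = 0 := fun i =>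
    integral_dd_eq_zero (hH i) (ρ := (r + R) / 2) (by linarith)
      (fun x hx => by simp [H, hψ.eq_zero t x hx]) i
  have hcH : ∀ i, Continuous fun x : E3 => dd (e i) (H i) (t, x) := fun i =>
    continuous_slice (smooth_dd (hH i) _).continuous t
  have c1 : Continuous fun x : E3 => ψ (t, x) ^ 2 * w (t, x) *
      ∑ i, (dd (e i) (dd (e i) w) (t, x) + dd (e i) (G i) (t, x)) :=
    continuous_slice (f := fun q => ψ q ^ 2 * w q *
      ∑ i, (dd (e i) (dd (e i) w) q + dd (e i) (G i) q)) (by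
        apply ContDiff.continuous (𝕜 := ℝ) (n := ∞); fun_prop) t
  have c2 : Continuous fun x : E3 => (- (1 / 2) * ψ (t, x) ^ 2 * ∑ i, dd (e i) w (t, x) ^ 2
        + 15 * K ^ 2 * w (t, x) ^ 2 + 2 * ∑ i, G i (t, x) ^ 2) :=
    continuous_slice (f := fun q => - (1 / 2) * ψ q ^ 2 * ∑ i, dd (e i) w q ^ 2
        + 15 * K ^ 2 * w q ^ 2 + 2 * ∑ i, G i q ^ 2) (by
        apply ContDiff.continuous (𝕜 := ℝ) (n := ∞); fun_prop) t
  have h0 : ∫ x in ball (0 : E3) R, ∑ i, dd (e i) (H i) (t, x) = 0 := by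
    rw [integral_finsetSum _ (fun i _ => integrableOn_ball (hcH i) R)]
    simp [hint]
  have hc0 : Continuous fun x : E3 => ∑ i, dd (e i) (H i) (t, x) := by fun_prop
  rw [← sub_zero (∫ x in ball (0 : E3) R, ψ (t, x) ^ 2 * w (t, x) *
      ∑ i, (dd (e i) (dd (e i) w) (t, x) + dd (e i) (G i) (t, x))), ← h0,
    ← integral_sub (integrableOn_ball c1 R) (integrableOn_ball hc0 R)]
  refine integral_ball_mono (c1.sub hc0) c2 fun x _ => ?_
  simp only [hdH, Pi.sub_apply]
  rw [Finset.mul_sum, ← Finset.sum_sub_distrib, Finset.mul_sum, Finset.mul_sum]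
  refine (Finset.sum_le_sum fun i _ => caccioppoli_pointwise (ψ (t, x)) (dd (e i) ψ (t, x))
    (w (t, x)) (dd (e i) w (t, x)) (G i (t, x)) _ _ K (hψ.nonneg _) (hψ.le_one _)
    (hψ.dd_le i _)).trans (le_of_eq ?_)
  rw [Finset.sum_add_distrib, Finset.sum_add_distrib]
  simp
  ring

/-- Caccioppoli's inequality for `Δ w + div G = 0` on a time slice. -/
lemma caccioppoli {r R : ℝ} (hr : 0 < r) (hrR : r < R) : ∃ C : ℝ, 0 ≤ C ∧
    ∀ (w : ST → ℝ) (G : Fin 3 → ST → ℝ), ContDiff ℝ ∞ w → (∀ i, ContDiff ℝ ∞ (G i)) → ∀ t : ℝ,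
      (∀ x ∈ ball (0 : E3) R,
        ∑ i, (dd (e i) (dd (e i) w) (t, x) + dd (e i) (G i) (t, x)) = 0) →
      ∫ x in ball (0 : E3) r, ∑ i, dd (e i) w (t, x) ^ 2 ≤
        C * ∫ x in ball (0 : E3) R, (w (t, x) ^ 2 + ∑ i, G i (t, x) ^ 2) := by
  obtain ⟨ψ, K, hψ⟩ := exists_cutoff hr hrR
  refine ⟨30 * K ^ 2 + 4, by positivity, fun w G hw hG t heq => ?_⟩
  have hs := hψ.smooth
  have h1 := fun i => smooth_dd hw (e i)
  have hA : ContDiff ℝ ∞ fun q => ψ q ^ 2 * ∑ i, dd (e i) w q ^ 2 := by fun_prop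
  have hB : ContDiff ℝ ∞ fun q => w q ^ 2 + ∑ i, G i q ^ 2 := by fun_prop
  have hC : ContDiff ℝ ∞ fun q => ∑ i, dd (e i) w q ^ 2 := by fun_prop
  have cA := continuous_slice hA.continuous t
  have cB := continuous_slice hB.continuous t
  have cC := continuous_slice hC.continuous t
  have key := caccioppoli_slice hrR hψ hw hG t
  have hz : ∫ x in ball (0 : E3) R, ψ (t, x) ^ 2 * w (t, x) *
      ∑ i, (dd (e i) (dd (e i) w) (t, x) + dd (e i) (G i) (t, x)) = 0 := by
    rw [setIntegral_congr_fun (g := fun _ => 0) measurableSet_ball]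
    · simp
    · intro x hx
      simp only [heq x hx, mul_zero]
  rw [hz] at key
  have hle : ∫ x in ball (0 : E3) R, (- (1 / 2) * ψ (t, x) ^ 2 * ∑ i, dd (e i) w (t, x) ^ 2
        + 15 * K ^ 2 * w (t, x) ^ 2 + 2 * ∑ i, G i (t, x) ^ 2) ≤
      ∫ x in ball (0 : E3) R, (- (1 / 2) * (ψ (t, x) ^ 2 * ∑ i, dd (e i) w (t, x) ^ 2)
        + (15 * K ^ 2 + 2) * (w (t, x) ^ 2 + ∑ i, G i (t, x) ^ 2)) := by
    refine integral_ball_mono ?_ (by fun_prop) fun x _ => ?_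
    · have : ContDiff ℝ ∞ fun q => - (1 / 2) * ψ q ^ 2 * ∑ i, dd (e i) w q ^ 2
        + 15 * K ^ 2 * w q ^ 2 + 2 * ∑ i, G i q ^ 2 := by fun_prop
      exact continuous_slice this.continuous t
    · have : 0 ≤ ∑ i, G i (t, x) ^ 2 := Finset.sum_nonneg fun i _ => sq_nonneg _
      nlinarith [sq_nonneg (w (t, x)), mul_nonneg (sq_nonneg K) this]
  replace key := key.trans hle
  rw [integral_add (integrableOn_ball (by fun_prop) R) (integrableOn_ball (by fun_prop) R),
    integral_const_mul, integral_const_mul] at key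
  have hlow : ∫ x in ball (0 : E3) r, ∑ i, dd (e i) w (t, x) ^ 2 ≤
      ∫ x in ball (0 : E3) R, ψ (t, x) ^ 2 * ∑ i, dd (e i) w (t, x) ^ 2 := by
    refine le_trans (integral_ball_mono cC cA fun x hx => ?_)
      (integral_ball_mono_set cA (fun x => ?_) hrR.le)
    · simp [hψ.eq_one t x hx]
    · exact mul_nonneg (sq_nonneg _) (Finset.sum_nonneg fun i _ => sq_nonneg _)
  linarith

lemma dd_time_weight (c : ℝ) : dd tt (fun q : ST => q.1 + c) = fun _ => 1 := by
  ext ⟨t, x⟩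
  have h := hasDerivAt_time (f := fun q : ST => q.1 + c) (by fun_prop) t x
  exact h.unique ((hasDerivAt_id t).add_const c)

/-- The weighted energy identity in time, integrated over the cylinder. -/
lemma integral_time_derivative {H : ST → ℝ} (hH : ContDiff ℝ ∞ H) {a s R : ℝ} (has : a ≤ s)
    (h0 : ∀ x, H (a, x) = 0) :
    ∫ q in cyl a s R, dd tt H q = ∫ x in ball (0 : E3) R, H (s, x) := by
  rw [integral_cyl_swap (smooth_dd hH tt).continuous]
  refine setIntegral_congr_fun measurableSet_ball fun x _ => ?_
  rw [integral_Icc_eq_integral_Ioc, ← intervalIntegral.integral_of_le has,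
    intervalIntegral.integral_eq_sub_of_hasDerivAt (fun t _ => hasDerivAt_time hH t x), h0, sub_zero]
  exact ((smooth_dd hH tt).continuous.comp (by fun_prop : Continuous fun t : ℝ =>
    ((t, x) : ST))).intervalIntegrable _ _

lemma energy_aux {r R K : ℝ} (hrR : r < R) {ψ : ST → ℝ} (hψ : IsCutoff r R K ψ)
    {w g : ST → ℝ} {G : Fin 3 → ST → ℝ} {T : ℝ} (hT : T ≤ 0) (hw : ContDiff ℝ ∞ w)
    (hG : ∀ i, ContDiff ℝ ∞ (G i)) (hg : ContDiff ℝ ∞ g)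
    (heq : ∀ t ∈ Icc (-R ^ 2) T, ∀ x ∈ ball (0 : E3) R, dd tt w (t, x) =
      ∑ i, (dd (e i) (dd (e i) w) (t, x) + dd (e i) (G i) (t, x)) + g (t, x))
    {s : ℝ} (hs : s ∈ Icc (-R ^ 2) T) :
    (∫ x in ball (0 : E3) R, (s + R ^ 2) * (ψ (s, x) ^ 2 * w (s, x) ^ 2)) +
      ∫ q in cyl (-R ^ 2) s R, (q.1 + R ^ 2) * (ψ q ^ 2 * ∑ i, dd (e i) w q ^ 2) ≤
    (1 + R ^ 2 * (30 * K ^ 2 + 6)) *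
      ∫ q in cyl (-R ^ 2) T R, (w q ^ 2 + ∑ i, G i q ^ 2 + |w q * g q|) := by
  have hψs := hψ.smooth
  have h1 := fun i => smooth_dd hw (e i)
  have h2 := fun i => smooth_dd (h1 i) (e i)
  have h3 := fun i => smooth_dd (hG i) (e i)
  have ht := smooth_dd hw tt
  let H : ST → ℝ := fun q => (q.1 + R ^ 2) * ((ψ q * ψ q) * (w q * w q))
  have hη : ContDiff ℝ ∞ (fun q : ST => q.1 + R ^ 2) := by fun_prop
  have hH : ContDiff ℝ ∞ H := by fun_prop
  have hdH : dd tt H = fun q =>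
      ψ q ^ 2 * w q ^ 2 + 2 * (q.1 + R ^ 2) * (ψ q ^ 2 * w q * dd tt w q) := by
    simp only [H]
    rw [dd_mul hη (by fun_prop), dd_mul (hψs.mul hψs) (hw.mul hw), dd_mul hψs hψs, dd_mul hw hw,
      dd_time_weight]
    ext q
    simp only [hψ.dd_time]
    ring
  have hI := integral_time_derivative hH (R := R) hs.1 (fun x => by simp [H])
  let B : ST → ℝ := fun q => (ψ q ^ 2 * w q ^ 2 + 2 * (q.1 + R ^ 2) *
    (- (1 / 2) * ψ q ^ 2 * ∑ i, dd (e i) w q ^ 2 + 15 * K ^ 2 * w q ^ 2 + 2 * ∑ i, G i q ^ 2))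
      + 2 * (q.1 + R ^ 2) * |w q * g q|
  have hBc : Continuous B := by
    have c1 : ContDiff ℝ ∞ fun q => ψ q ^ 2 * w q ^ 2 + 2 * (q.1 + R ^ 2) *
      (- (1 / 2) * ψ q ^ 2 * ∑ i, dd (e i) w q ^ 2 + 15 * K ^ 2 * w q ^ 2
        + 2 * ∑ i, G i q ^ 2) := by fun_prop
    have c2 := (hw.mul hg).continuous.abs
    exact c1.continuous.add (by fun_prop)
  have hslice : ∀ t ∈ Icc (-R ^ 2) s, ∫ x in ball (0 : E3) R, dd tt H (t, x) ≤
      ∫ x in ball (0 : E3) R, B (t, x) := by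
    intro t htI
    have ht0 : 0 ≤ t + R ^ 2 := by linarith [htI.1]
    have hc := caccioppoli_slice hrR hψ hw hG t
    have a1 : ContDiff ℝ ∞ fun q => ψ q ^ 2 * w q *
      ∑ i, (dd (e i) (dd (e i) w) q + dd (e i) (G i) q) := by fun_prop
    have a2 : ContDiff ℝ ∞ fun q => ψ q ^ 2 * w q ^ 2 := by fun_prop
    have a3 : ContDiff ℝ ∞ fun q => ψ q ^ 2 * (w q * g q) := by fun_prop
    have a4 : ContDiff ℝ ∞ fun q => (- (1 / 2) * ψ q ^ 2 * ∑ i, dd (e i) w q ^ 2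
      + 15 * K ^ 2 * w q ^ 2 + 2 * ∑ i, G i q ^ 2) := by fun_prop
    have c1 := continuous_slice a1.continuous t
    have c2 := continuous_slice a2.continuous t
    have c3 := continuous_slice a3.continuous t
    have c4 := continuous_slice a4.continuous t
    have c5 := continuous_slice (hw.mul hg).continuous.abs t
    calc ∫ x in ball (0 : E3) R, dd tt H (t, x)
        = ∫ x in ball (0 : E3) R, ((ψ (t, x) ^ 2 * w (t, x) ^ 2 + 2 * (t + R ^ 2) *
            (ψ (t, x) ^ 2 * w (t, x) *
              ∑ i, (dd (e i) (dd (e i) w) (t, x) + dd (e i) (G i) (t, x))))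
            + 2 * (t + R ^ 2) * (ψ (t, x) ^ 2 * (w (t, x) * g (t, x)))) := by
          refine setIntegral_congr_fun measurableSet_ball fun x hx => ?_
          simp only [hdH]
          rw [heq t ⟨htI.1, htI.2.trans hs.2⟩ x hx]
          ring
      _ = (∫ x in ball (0 : E3) R, ψ (t, x) ^ 2 * w (t, x) ^ 2) + 2 * (t + R ^ 2) *
            (∫ x in ball (0 : E3) R, ψ (t, x) ^ 2 * w (t, x) *
              ∑ i, (dd (e i) (dd (e i) w) (t, x) + dd (e i) (G i) (t, x)))
            + 2 * (t + R ^ 2) *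
              ∫ x in ball (0 : E3) R, ψ (t, x) ^ 2 * (w (t, x) * g (t, x)) := by
          rw [integral_add (integrableOn_ball (by fun_prop) R)
            (integrableOn_ball (by fun_prop) R), integral_add (integrableOn_ball (by fun_prop) R)
            (integrableOn_ball (by fun_prop) R), integral_const_mul, integral_const_mul]
      _ ≤ (∫ x in ball (0 : E3) R, ψ (t, x) ^ 2 * w (t, x) ^ 2) + 2 * (t + R ^ 2) *
            (∫ x in ball (0 : E3) R, (- (1 / 2) * ψ (t, x) ^ 2 * ∑ i, dd (e i) w (t, x) ^ 2
              + 15 * K ^ 2 * w (t, x) ^ 2 + 2 * ∑ i, G i (t, x) ^ 2))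
            + 2 * (t + R ^ 2) * ∫ x in ball (0 : E3) R, |w (t, x) * g (t, x)| := by
          have hle : ∫ x in ball (0 : E3) R, ψ (t, x) ^ 2 * (w (t, x) * g (t, x)) ≤
              ∫ x in ball (0 : E3) R, |w (t, x) * g (t, x)| := by
            refine integral_ball_mono c3 c5 fun x _ => ?_
            have p0 := hψ.nonneg (t, x)
            have p1 := hψ.le_one (t, x)
            have p2 : ψ (t, x) ^ 2 ≤ 1 := by nlinarith
            calc ψ (t, x) ^ 2 * (w (t, x) * g (t, x))
                ≤ ψ (t, x) ^ 2 * |w (t, x) * g (t, x)| := by gcongr; exact le_abs_self _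
              _ ≤ 1 * |w (t, x) * g (t, x)| := by gcongr
              _ = _ := one_mul _
          gcongr
      _ = ∫ x in ball (0 : E3) R, B (t, x) := by
          simp only [B]
          conv_rhs => rw [integral_add (integrableOn_ball (by fun_prop) R)
            (integrableOn_ball (by fun_prop) R), integral_add (integrableOn_ball (by fun_prop) R)
            (integrableOn_ball (by fun_prop) R), integral_const_mul, integral_const_mul]
  have hFB : ∫ q in cyl (-R ^ 2) s R, dd tt H q ≤ ∫ q in cyl (-R ^ 2) s R, B q := by
    rw [integral_cyl (smooth_dd hH tt).continuous, integral_cyl hBc]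
    exact setIntegral_mono_on (integrableOn_slice (smooth_dd hH tt).continuous _ _ _)
      (integrableOn_slice hBc _ _ _) measurableSet_Icc hslice
  let M : ST → ℝ := fun q => w q ^ 2 + ∑ i, G i q ^ 2 + |w q * g q|
  let S : ST → ℝ := fun q => (q.1 + R ^ 2) * (ψ q ^ 2 * ∑ i, dd (e i) w q ^ 2)
  have hMc : Continuous M := by
    have c1 : ContDiff ℝ ∞ fun q => w q ^ 2 + ∑ i, G i q ^ 2 := by fun_prop
    exact c1.continuous.add (hw.mul hg).continuous.abs
  have hSc : Continuous S := by
    have c1 : ContDiff ℝ ∞ S := by fun_prop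
    exact c1.continuous
  have hM0 : ∀ q, 0 ≤ M q := fun q => by
    have : 0 ≤ ∑ i, G i q ^ 2 := Finset.sum_nonneg fun i _ => sq_nonneg _
    positivity
  have hBle : ∫ q in cyl (-R ^ 2) s R, B q ≤ ∫ q in cyl (-R ^ 2) s R,
      ((1 + R ^ 2 * (30 * K ^ 2 + 6)) * M q - S q) := by
    refine integral_cyl_mono hBc (by fun_prop) fun q hq => ?_
    have q0 : 0 ≤ q.1 + R ^ 2 := by linarith [hq.1.1]
    have q1 : q.1 + R ^ 2 ≤ R ^ 2 := by linarith [hq.1.2, hs.2]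
    have p0 := hψ.nonneg q
    have p1 := hψ.le_one q
    have p2 : ψ q ^ 2 ≤ 1 := by nlinarith
    have g0 : 0 ≤ ∑ i, G i q ^ 2 := Finset.sum_nonneg fun i _ => sq_nonneg _
    have a0 : 0 ≤ |w q * g q| := abs_nonneg _
    have b1 : ψ q ^ 2 * w q ^ 2 ≤ 1 * w q ^ 2 := by gcongr
    have b2 : (q.1 + R ^ 2) * (30 * K ^ 2 * w q ^ 2 + 4 * ∑ i, G i q ^ 2 + 2 * |w q * g q|) ≤
        R ^ 2 * ((30 * K ^ 2 + 6) * M q) := by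
      refine mul_le_mul q1 ?_ (by positivity) (by positivity)
      have b3 : 0 ≤ K ^ 2 * ∑ i, G i q ^ 2 := by positivity
      have b4 : 0 ≤ K ^ 2 * |w q * g q| := by positivity
      simp only [M]
      nlinarith [sq_nonneg (w q)]
    have b5 : w q ^ 2 ≤ M q := by simp only [M]; linarith
    simp only [B, S]
    linarith
  rw [integral_sub (integrableOn_cyl (by fun_prop) _ _ _) (integrableOn_cyl hSc _ _ _),
    integral_const_mul] at hBle
  have hmono : ∫ q in cyl (-R ^ 2) s R, M q ≤ ∫ q in cyl (-R ^ 2) T R, M q :=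
    integral_cyl_mono_set hMc hM0 le_rfl hs.2 le_rfl
  have hfin := mul_le_mul_of_nonneg_left hmono
    (by positivity : 0 ≤ 1 + R ^ 2 * (30 * K ^ 2 + 6))
  have hHe : ∫ x in ball (0 : E3) R, (s + R ^ 2) * (ψ (s, x) ^ 2 * w (s, x) ^ 2) =
      ∫ x in ball (0 : E3) R, H (s, x) := by
    refine setIntegral_congr_fun measurableSet_ball fun x _ => ?_
    simp only [H]; ring
  rw [hHe]
  simp only [M, S] at *
  linarith

/-- Local energy estimate for the forced heat equation `∂ₜ w = Δ w + div G + g`. -/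
lemma energy {r R : ℝ} (hr : 0 < r) (hrR : r < R) : ∃ C : ℝ, 0 ≤ C ∧
    ∀ (w g : ST → ℝ) (G : Fin 3 → ST → ℝ) (T : ℝ), T ≤ 0 → ContDiff ℝ ∞ w →
      (∀ i, ContDiff ℝ ∞ (G i)) → ContDiff ℝ ∞ g →
      (∀ t ∈ Icc (-R ^ 2) T, ∀ x ∈ ball (0 : E3) R, dd tt w (t, x) =
        ∑ i, (dd (e i) (dd (e i) w) (t, x) + dd (e i) (G i) (t, x)) + g (t, x)) →
      (∀ s ∈ Icc (-r ^ 2) T, ∫ x in ball (0 : E3) r, w (s, x) ^ 2 ≤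
        C * ∫ q in cyl (-R ^ 2) T R, (w q ^ 2 + ∑ i, G i q ^ 2 + |w q * g q|)) ∧
      ∫ q in cyl (-r ^ 2) T r, ∑ i, dd (e i) w q ^ 2 ≤
        C * ∫ q in cyl (-R ^ 2) T R, (w q ^ 2 + ∑ i, G i q ^ 2 + |w q * g q|) := by
  obtain ⟨ψ, K, hψ⟩ := exists_cutoff hr hrR
  have hd : 0 < R ^ 2 - r ^ 2 := by nlinarith
  refine ⟨(1 + R ^ 2 * (30 * K ^ 2 + 6)) / (R ^ 2 - r ^ 2), by positivity,
    fun w g G T hT hw hG hg heq => ?_⟩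
  have hψs := hψ.smooth
  have h1 := fun i => smooth_dd hw (e i)
  have aux := fun s hs => energy_aux hrR hψ hT hw hG hg heq (s := s) hs
  set M := ∫ q in cyl (-R ^ 2) T R, (w q ^ 2 + ∑ i, G i q ^ 2 + |w q * g q|) with hM
  have hM0 : 0 ≤ M := integral_nonneg fun q => by
    have : 0 ≤ ∑ i, G i q ^ 2 := Finset.sum_nonneg fun i _ => sq_nonneg _
    positivity
  let S : ST → ℝ := fun q => (q.1 + R ^ 2) * (ψ q ^ 2 * ∑ i, dd (e i) w q ^ 2)
  have hS : ContDiff ℝ ∞ S := by fun_prop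
  have hS0 : ∀ q : ST, 0 ≤ q.1 + R ^ 2 → 0 ≤ S q := fun q hq =>
    mul_nonneg hq (mul_nonneg (sq_nonneg _) (Finset.sum_nonneg fun i _ => sq_nonneg _))
  constructor
  · intro s hs
    rw [div_mul_eq_mul_div, le_div_iff₀ hd]
    refine le_trans ?_ (aux s ⟨by nlinarith [hs.1], hs.2⟩)
    have hnn : 0 ≤ ∫ q in cyl (-R ^ 2) s R, S q :=
      setIntegral_nonneg (measurableSet_cyl _ _ _) fun q hq => hS0 q (by linarith [hq.1.1])
    have a1 : ContDiff ℝ ∞ fun q : ST => (s + R ^ 2) * (ψ q ^ 2 * w q ^ 2) := by fun_prop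
    have c1 := continuous_slice a1.continuous s
    have c2 := continuous_slice hw.continuous s
    have hle : (R ^ 2 - r ^ 2) * ∫ x in ball (0 : E3) r, w (s, x) ^ 2 ≤
        ∫ x in ball (0 : E3) R, (s + R ^ 2) * (ψ (s, x) ^ 2 * w (s, x) ^ 2) := by
      rw [← integral_const_mul]
      refine le_trans (integral_ball_mono (by fun_prop) c1 fun x hx => ?_)
        (integral_ball_mono_set c1 (fun x => ?_) hrR.le)
      · rw [hψ.eq_one s x hx]
        nlinarith [hs.1, sq_nonneg (w (s, x))]
      · have : 0 ≤ s + R ^ 2 := by nlinarith [hs.1]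
        positivity
    linarith
  · rcases lt_or_ge T (-r ^ 2) with hlt | hge
    · have : cyl (-r ^ 2) T r = ∅ := by simp [cyl, Icc_eq_empty_of_lt hlt]
      rw [this]
      simp only [setIntegral_empty]
      positivity
    · rw [div_mul_eq_mul_div, le_div_iff₀ hd]
      have hTI : T ∈ Icc (-R ^ 2) T := ⟨by nlinarith, le_rfl⟩
      refine le_trans ?_ (aux T hTI)
      have hnn : 0 ≤ ∫ x in ball (0 : E3) R, (T + R ^ 2) * (ψ (T, x) ^ 2 * w (T, x) ^ 2) :=
        integral_nonneg fun x => by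
          have : 0 ≤ T + R ^ 2 := by linarith [hTI.1]
          positivity
      have a2 : ContDiff ℝ ∞ fun q => (R ^ 2 - r ^ 2) * ∑ i, dd (e i) w q ^ 2 := by fun_prop
      have hle : (R ^ 2 - r ^ 2) * ∫ q in cyl (-r ^ 2) T r, ∑ i, dd (e i) w q ^ 2 ≤
          ∫ q in cyl (-R ^ 2) T R, S q := by
        rw [← integral_const_mul]
        have hsub : cyl (-r ^ 2) T r ⊆ cyl (-R ^ 2) T R :=
          prod_mono (Icc_subset_Icc (by nlinarith) le_rfl) (ball_subset_ball hrR.le)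
        refine le_trans (integral_cyl_mono a2.continuous hS.continuous fun q hq => ?_)
          (setIntegral_mono_set (integrableOn_cyl hS.continuous _ _ _) ?_ hsub.eventuallyLE)
        · simp only [S]
          rw [hψ.eq_one q.1 q.2 hq.2]
          have : 0 ≤ ∑ i, dd (e i) w q ^ 2 := Finset.sum_nonneg fun i _ => sq_nonneg _
          nlinarith [hq.1.1]
        · filter_upwards [ae_restrict_mem (measurableSet_cyl _ _ _)] with q hq
          exact hS0 q (by linarith [hq.1.1])
      linarith

open scoped SchwartzMap FourierTransform LineDeriv in
lemma norm_fourier_lineDeriv (g : 𝓢(E3, ℂ)) (j : Fin 3) (ξ : E3) :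
    ‖𝓕 (∂_{EuclideanSpace.single j (1 : ℝ)} g) ξ‖ = 2 * Real.pi * (|ξ j| * ‖𝓕 g ξ‖) := by
  have h : (inner ℝ · (EuclideanSpace.single j (1 : ℝ)) : E3 → ℝ).HasTemperateGrowth := by fun_prop
  rw [SchwartzMap.fourier_lineDerivOp_eq, smul_apply, SchwartzMap.smulLeftCLM_apply_apply h]
  simp [EuclideanSpace.inner_single_right, abs_of_pos Real.pi_pos]

open scoped SchwartzMap FourierTransform LineDeriv in
lemma norm_fourier_second (g : 𝓢(E3, ℂ)) (j : Fin 3) (ξ : E3) :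
    ξ j ^ 2 * ‖𝓕 g ξ‖ ≤ ‖𝓕 (∂_{EuclideanSpace.single j (1 : ℝ)}
      (∂_{EuclideanSpace.single j (1 : ℝ)} g)) ξ‖ := by
  rw [norm_fourier_lineDeriv, norm_fourier_lineDeriv]
  have h1 : 1 ≤ 2 * Real.pi := by linarith [Real.pi_gt_three]
  have h2 : 1 ≤ (2 * Real.pi) * (2 * Real.pi) := by nlinarith
  calc ξ j ^ 2 * ‖𝓕 g ξ‖ ≤ ((2 * Real.pi) * (2 * Real.pi)) * (ξ j ^ 2 * ‖𝓕 g ξ‖) :=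
        le_mul_of_one_le_left (by positivity) h2
    _ = _ := by rw [← sq_abs (ξ j)]; ring

open scoped SchwartzMap FourierTransform LineDeriv in
lemma weighted_fourier_le (g : 𝓢(E3, ℂ)) (ξ : E3) :
    (1 + ‖ξ‖ ^ 2) ^ 2 * ‖𝓕 g ξ‖ ^ 2 ≤ 4 * (‖𝓕 g ξ‖ ^ 2 + ∑ j : Fin 3,
      ‖𝓕 (∂_{EuclideanSpace.single j (1 : ℝ)} (∂_{EuclideanSpace.single j (1 : ℝ)} g)) ξ‖ ^ 2) := by
  have h := fun j => norm_fourier_second g j ξ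
  have h2 : ∀ j, (ξ j ^ 2 * ‖𝓕 g ξ‖) ^ 2 ≤
      ‖𝓕 (∂_{EuclideanSpace.single j (1 : ℝ)} (∂_{EuclideanSpace.single j (1 : ℝ)} g)) ξ‖ ^ 2 :=
    fun j => pow_le_pow_left₀ (by positivity) (h j) 2
  rw [EuclideanSpace.norm_sq_eq, Fin.sum_univ_three, Fin.sum_univ_three]
  simp only [Real.norm_eq_abs, sq_abs]
  have a0 := h2 0
  have a1 := h2 1
  have a2 := h2 2
  have e : (1 + (ξ 0 ^ 2 + ξ 1 ^ 2 + ξ 2 ^ 2)) ^ 2 ≤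
      4 * (1 + (ξ 0 ^ 2) ^ 2 + (ξ 1 ^ 2) ^ 2 + (ξ 2 ^ 2) ^ 2) := by
    nlinarith [sq_nonneg (ξ 0 ^ 2 - ξ 1 ^ 2), sq_nonneg (ξ 0 ^ 2 - ξ 2 ^ 2),
      sq_nonneg (ξ 1 ^ 2 - ξ 2 ^ 2), sq_nonneg (ξ 0 ^ 2 - 1), sq_nonneg (ξ 1 ^ 2 - 1),
      sq_nonneg (ξ 2 ^ 2 - 1)]
  have e2 := mul_le_mul_of_nonneg_right e (sq_nonneg ‖𝓕 g ξ‖)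
  nlinarith

lemma sq_le_of_forall_le {s I B : ℝ} (hs : 0 ≤ s) (hI : 0 < I)
    (h : ∀ l > 0, s ≤ l * I + B / (4 * l)) : s ^ 2 ≤ I * B := by
  rcases hs.eq_or_lt with rfl | hs
  · have hB : 0 ≤ B := by
      by_contra! hB
      have h1 := h (Real.sqrt (-B / (8 * I))) (Real.sqrt_pos.2 (div_pos (by linarith) (by linarith)))
      set l := Real.sqrt (-B / (8 * I)) with hl
      have hl0 : 0 < l := Real.sqrt_pos.2 (div_pos (by linarith) (by linarith))
      have hl2 : l ^ 2 = -B / (8 * I) := Real.sq_sqrt (div_nonneg (by linarith) (by linarith))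
      have hl3 : l ^ 2 * (8 * I) = - B := by rw [hl2]; field_simp
      have h2 : 0 ≤ (l * I + B / (4 * l)) * (4 * l) := mul_nonneg h1 (by linarith)
      have h3 : (l * I + B / (4 * l)) * (4 * l) = 4 * l ^ 2 * I + B := by field_simp
      nlinarith
    simpa using mul_nonneg hI.le hB
  · have h1 := h (s / (2 * I)) (by positivity)
    have h2 := mul_le_mul_of_nonneg_right h1 (by positivity : 0 ≤ 2 * s)
    have h3 : (s / (2 * I) * I + B / (4 * (s / (2 * I)))) * (2 * s) = s ^ 2 + I * B := by
      field_simp; ring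
    nlinarith

open scoped SchwartzMap FourierTransform LineDeriv in
lemma schwartz_sobolev : ∃ A : ℝ, 0 ≤ A ∧ ∀ (g : 𝓢(E3, ℂ)) (x : E3),
    ‖g x‖ ^ 2 ≤ A * ((∫ y, ‖g y‖ ^ 2) + ∑ j : Fin 3, ∫ y,
      ‖(∂_{EuclideanSpace.single j (1 : ℝ)} (∂_{EuclideanSpace.single j (1 : ℝ)} g)) y‖ ^ 2) := by
  let W : E3 → ℝ := fun ξ => (1 + ‖ξ‖ ^ 2) ^ (-4 / 2 : ℝ)
  have hW : Integrable W := integrable_rpow_neg_one_add_norm_sq (by simp; norm_num)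
  have hWe : ∀ ξ, W ξ * (1 + ‖ξ‖ ^ 2) ^ 2 = 1 := fun ξ => by
    have : (0 : ℝ) < 1 + ‖ξ‖ ^ 2 := by positivity
    simp only [W]
    rw [show (-4 / 2 : ℝ) = -(2 : ℕ) by norm_num, Real.rpow_neg this.le, Real.rpow_natCast]
    field_simp
  have hW0 : ∀ ξ, 0 ≤ W ξ := fun ξ => by positivity
  have hI0 : 0 ≤ ∫ ξ, W ξ := integral_nonneg hW0
  refine ⟨((∫ ξ, W ξ) + 1) * 4, by positivity, fun g x => ?_⟩
  have hsq : ∀ h : 𝓢(E3, ℂ), Integrable fun ξ => ‖h ξ‖ ^ 2 := fun h =>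
    (h.memLp 2 volume).integrable_norm_pow (by norm_num)
  let h : Fin 3 → 𝓢(E3, ℂ) := fun j =>
    ∂_{EuclideanSpace.single j (1 : ℝ)} (∂_{EuclideanSpace.single j (1 : ℝ)} g)
  have hB : Integrable fun ξ => 4 * (‖𝓕 g ξ‖ ^ 2 + ∑ j, ‖𝓕 (h j) ξ‖ ^ 2) :=
    ((hsq (𝓕 g)).add (integrable_finsetSum _ fun j _ => hsq (𝓕 (h j)))).const_mul 4
  have hle : ‖g x‖ ≤ ∫ ξ, ‖𝓕 g ξ‖ := by
    have h0 : g x = ∫ ξ, Real.fourierChar (inner ℝ ξ x) • 𝓕 g ξ := by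
      conv_lhs => rw [← FourierTransform.fourierInv_fourier_eq (F := 𝓢(E3, ℂ)) g]
      rw [SchwartzMap.fourierInv_coe, Real.fourierInv_eq]
    rw [h0]
    refine (norm_integral_le_integral_norm _).trans (le_of_eq ?_)
    simp [Circle.norm_smul]
  have hs : (∫ ξ, ‖𝓕 g ξ‖) ^ 2 ≤ ((∫ ξ, W ξ) + 1) *
      ∫ ξ, 4 * (‖𝓕 g ξ‖ ^ 2 + ∑ j, ‖𝓕 (h j) ξ‖ ^ 2) := by
    refine sq_le_of_forall_le (integral_nonneg fun _ => norm_nonneg _) (by linarith)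
      fun l hl => ?_
    have : ∫ ξ, ‖𝓕 g ξ‖ ≤ ∫ ξ, (l * W ξ + (4 * (‖𝓕 g ξ‖ ^ 2 + ∑ j, ‖𝓕 (h j) ξ‖ ^ 2)) / (4 * l)) := by
      refine integral_mono (𝓕 g).integrable.norm ((hW.const_mul l).add (hB.div_const _))
        fun ξ => ?_
      have hw := weighted_fourier_le g ξ
      have he := hWe ξ
      set N := ‖𝓕 g ξ‖
      set Y := (1 + ‖ξ‖ ^ 2) ^ 2
      have hY : 0 < Y := by positivity
      have h5 : N ≤ l * W ξ + Y * N ^ 2 / (4 * l) := by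
        have hWY : W ξ = 1 / Y := by field_simp; exact he
        rw [hWY]
        have : l * (1 / Y) + Y * N ^ 2 / (4 * l) - N = (2 * l - Y * N) ^ 2 / (4 * l * Y) := by
          field_simp; ring
        have h6 : 0 ≤ (2 * l - Y * N) ^ 2 / (4 * l * Y) := by positivity
        linarith
      refine h5.trans ?_
      gcongr
    rw [integral_add (hW.const_mul l) (hB.div_const _), integral_const_mul, integral_div] at this
    refine this.trans ?_
    gcongr
    linarith
  rw [integral_const_mul, integral_add (hsq _) (integrable_finsetSum _ fun j _ => hsq (𝓕 (h j))),
    integral_finsetSum _ fun j _ => hsq (𝓕 (h j))] at hs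
  have hP : ∀ f : 𝓢(E3, ℂ), ∫ ξ, ‖𝓕 f ξ‖ ^ 2 = ∫ y, ‖f y‖ ^ 2 :=
    SchwartzMap.integral_norm_sq_fourier
  simp only [hP] at hs
  calc ‖g x‖ ^ 2 ≤ (∫ ξ, ‖𝓕 g ξ‖) ^ 2 := pow_le_pow_left₀ (norm_nonneg _) hle 2
    _ ≤ _ := by rw [mul_assoc]; exact hs

open scoped SchwartzMap LineDeriv in
lemma lineDeriv_slice {F : ST → ℝ} (hF : ContDiff ℝ ∞ F) {t : ℝ} {g : 𝓢(E3, ℂ)}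
    (hg : ∀ y, g y = (F (t, y) : ℂ)) (j : Fin 3) (y : E3) :
    (∂_{EuclideanSpace.single j (1 : ℝ)} g) y = (dd (e j) F (t, y) : ℂ) := by
  rw [SchwartzMap.lineDerivOp_apply_eq_fderiv, ← dd_slice hF]
  have h1 : (g : E3 → ℂ) = fun y => Complex.ofRealCLM (F (t, y)) := funext hg
  have h2 := (Complex.ofRealCLM.hasFDerivAt (x := F (t, y))).comp y
    (hasFDerivAt_slice hF t y).differentiableAt.hasFDerivAt
  rw [h1, show (fun y => Complex.ofRealCLM (F (t, y))) =
    Complex.ofRealCLM ∘ fun y => F (t, y) from rfl, h2.fderiv]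
  rfl

lemma second_deriv_mul_sq_le (p p' p'' f d s K : ℝ) (h0 : |p| ≤ 1) (h1 : |p'| ≤ K)
    (h2 : |p''| ≤ K) : ((p'' * f + p' * d) + (p' * d + p * s)) ^ 2 ≤
      (12 * K ^ 2 + 3) * (f ^ 2 + d ^ 2 + s ^ 2) := by
  have e0 : p ^ 2 ≤ 1 := by rw [← sq_abs]; nlinarith [abs_nonneg p]
  have e1 : p' ^ 2 ≤ K ^ 2 := by rw [← sq_abs p']; gcongr
  have e2 : p'' ^ 2 ≤ K ^ 2 := by rw [← sq_abs p'']; gcongr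
  have a0 := mul_le_mul_of_nonneg_right e0 (sq_nonneg s)
  have a1 := mul_le_mul_of_nonneg_right e1 (sq_nonneg d)
  have a2 := mul_le_mul_of_nonneg_right e2 (sq_nonneg f)
  have b : ((p'' * f + p' * d) + (p' * d + p * s)) ^ 2 ≤
      3 * (p'' ^ 2 * f ^ 2 + 4 * (p' ^ 2 * d ^ 2) + p ^ 2 * s ^ 2) := by
    nlinarith [sq_nonneg (p'' * f - 2 * (p' * d)), sq_nonneg (p'' * f - p * s),
      sq_nonneg (2 * (p' * d) - p * s)]
  nlinarith [mul_nonneg (sq_nonneg K) (sq_nonneg f), mul_nonneg (sq_nonneg K) (sq_nonneg s),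
    sq_nonneg f, sq_nonneg d, sq_nonneg s]

/-- The local Sobolev inequality `H² ⊂ L^∞` on time slices. -/
lemma sobolev {r R : ℝ} (hr : 0 < r) (hrR : r < R) : ∃ C : ℝ, 0 ≤ C ∧
    ∀ f : ST → ℝ, ContDiff ℝ ∞ f → ∀ t, ∀ x ∈ ball (0 : E3) r, f (t, x) ^ 2 ≤
      C * ∫ y in ball (0 : E3) R, (f (t, y) ^ 2 + ∑ j, dd (e j) f (t, y) ^ 2 +
        ∑ j, dd (e j) (dd (e j) f) (t, y) ^ 2) := by
  obtain ⟨ψ, K, hψ⟩ := exists_cutoff hr hrR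
  obtain ⟨A, hA0, hA⟩ := schwartz_sobolev
  refine ⟨A * (1 + 3 * (12 * K ^ 2 + 3)), by positivity, fun f hf t x hx => ?_⟩
  have hψs := hψ.smooth
  have h1 := fun i => smooth_dd hf (e i)
  have h2 := fun i => smooth_dd (h1 i) (e i)
  have p1 := fun i => smooth_dd hψs (e i)
  have p2 := fun i => smooth_dd (p1 i) (e i)
  let F : ST → ℝ := fun q => ψ q * f q
  have hF : ContDiff ℝ ∞ F := hψs.mul hf
  have hF1 : ∀ j, ContDiff ℝ ∞ (dd (e j) F) := fun j => smooth_dd hF _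
  have hF2 : ∀ j, ContDiff ℝ ∞ (dd (e j) (dd (e j) F)) := fun j => smooth_dd (hF1 j) _
  have hFd : ∀ j, dd (e j) (dd (e j) F) = fun q =>
      (dd (e j) (dd (e j) ψ) q * f q + dd (e j) ψ q * dd (e j) f q) +
        (dd (e j) ψ q * dd (e j) f q + ψ q * dd (e j) (dd (e j) f) q) := fun j => by
    simp only [F]
    rw [dd_mul hψs hf, dd_add ((p1 j).mul hf) (hψs.mul (h1 j)), dd_mul (p1 j) hf,
      dd_mul hψs (h1 j)]
  have hz : ∀ y, (r + R) / 2 ≤ ‖y‖ → F (t, y) = 0 := fun y hy => by simp [F, hψ.eq_zero t y hy]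
  have hz2 : ∀ j y, y ∉ ball (0 : E3) R → dd (e j) (dd (e j) F) (t, y) = 0 := fun j y hy => by
    have hy' : R ≤ ‖y‖ := by simpa using hy
    refine eq_zero_of_dd (ρ := (r + 3 * R) / 4) (hF1 j)
      (fun z hz' => eq_zero_of_dd (ρ := (r + R) / 2) hF hz j (by linarith)) j (by linarith)
  have hsupp : HasCompactSupport fun y : E3 => ((F (t, y) : ℝ) : ℂ) :=
    HasCompactSupport.intro (isCompact_closedBall (0 : E3) ((r + R) / 2)) fun y hy => by
      simp only [mem_closedBall, dist_zero_right, not_le] at hy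
      simp [hz y hy.le]
  have hsm : ContDiff ℝ ∞ fun y : E3 => ((F (t, y) : ℝ) : ℂ) :=
    Complex.ofRealCLM.contDiff.comp (hF.comp (by fun_prop : ContDiff ℝ ∞ fun y : E3 => ((t, y) : ST)))
  have hg : ∀ y, hsupp.toSchwartzMap hsm y = (F (t, y) : ℂ) := fun y => rfl
  have key := hA (hsupp.toSchwartzMap hsm) x
  simp only [lineDeriv_slice (hF1 _) (lineDeriv_slice hF hg _), hg, Complex.norm_real,
    Real.norm_eq_abs, sq_abs] at key
  have hFx : F (t, x) = f (t, x) := by simp [F, hψ.eq_one t x hx]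
  rw [hFx] at key
  refine key.trans ?_
  rw [mul_assoc]
  refine mul_le_mul_of_nonneg_left ?_ hA0
  let N : ST → ℝ := fun q => f q ^ 2 + ∑ j, dd (e j) f q ^ 2 + ∑ j, dd (e j) (dd (e j) f) q ^ 2
  have hN : ContDiff ℝ ∞ N := by fun_prop
  have cN := continuous_slice hN.continuous t
  have i0 : ∫ y, F (t, y) ^ 2 ≤ ∫ y in ball (0 : E3) R, N (t, y) := by
    rw [← setIntegral_eq_integral_of_forall_compl_eq_zero (s := ball (0 : E3) R) fun y hy => by
      have hy' : R ≤ ‖y‖ := by simpa using hy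
      simp [hz y (by linarith)]]
    refine integral_ball_mono (continuous_slice (hF.pow 2).continuous t) cN fun y _ => ?_
    have q0 := hψ.nonneg (t, y)
    have q1 := hψ.le_one (t, y)
    have q2 : ψ (t, y) ^ 2 ≤ 1 := by nlinarith
    have s1 : 0 ≤ ∑ j, dd (e j) f (t, y) ^ 2 := Finset.sum_nonneg fun j _ => sq_nonneg _
    have s2 : 0 ≤ ∑ j, dd (e j) (dd (e j) f) (t, y) ^ 2 := Finset.sum_nonneg fun j _ => sq_nonneg _
    simp only [F, N, mul_pow]
    nlinarith [mul_le_mul_of_nonneg_right q2 (sq_nonneg (f (t, y)))]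
  have i2 : ∀ j, ∫ y, dd (e j) (dd (e j) F) (t, y) ^ 2 ≤
      (12 * K ^ 2 + 3) * ∫ y in ball (0 : E3) R, N (t, y) := fun j => by
    rw [← setIntegral_eq_integral_of_forall_compl_eq_zero (s := ball (0 : E3) R) fun y hy => by
      simp [hz2 j y hy], ← integral_const_mul]
    refine integral_ball_mono (continuous_slice ((hF2 j).pow 2).continuous t) (by fun_prop)
      fun y _ => ?_
    rw [hFd]
    refine (second_deriv_mul_sq_le _ _ _ _ _ _ K ?_ (hψ.dd_le j _) (hψ.dd_dd_le j _)).trans ?_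
    · rw [abs_of_nonneg (hψ.nonneg _)]
      exact hψ.le_one _
    · have s1 : dd (e j) f (t, y) ^ 2 ≤ ∑ j, dd (e j) f (t, y) ^ 2 :=
        Finset.single_le_sum (f := fun j => dd (e j) f (t, y) ^ 2) (fun j _ => sq_nonneg _)
          (Finset.mem_univ j)
      have s2 : dd (e j) (dd (e j) f) (t, y) ^ 2 ≤ ∑ j, dd (e j) (dd (e j) f) (t, y) ^ 2 :=
        Finset.single_le_sum (f := fun j => dd (e j) (dd (e j) f) (t, y) ^ 2)
          (fun j _ => sq_nonneg _) (Finset.mem_univ j)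
      simp only [N]
      gcongr
  calc (∫ y, F (t, y) ^ 2) + ∑ j, ∫ y, dd (e j) (dd (e j) F) (t, y) ^ 2
      ≤ (∫ y in ball (0 : E3) R, N (t, y)) +
        ∑ _j : Fin 3, (12 * K ^ 2 + 3) * ∫ y in ball (0 : E3) R, N (t, y) :=
        add_le_add i0 (Finset.sum_le_sum fun j _ => i2 j)
    _ = (1 + 3 * (12 * K ^ 2 + 3)) * ∫ y in ball (0 : E3) R, N (t, y) := by
        simp; ring

lemma quartic_pointwise (p p' f g h K : ℝ) (h0 : 0 ≤ p) (h1 : p ≤ 1) (hK : |p'| ≤ K)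
    (hf : |f| ≤ 1) : p ^ 2 * g ^ 4 / 2 ≤ ((p' * p + p * p') * (g * g * g * f) +
      p * p * (((h * g + g * h) * g + g * g * h) * f + g * g * g * g)) +
      (4 * K ^ 2 + 9) * (g ^ 2 + h ^ 2) := by
  have e0 : p ^ 2 ≤ 1 := by nlinarith
  have e1 : p' ^ 2 ≤ K ^ 2 := by rw [← sq_abs p']; gcongr
  have e2 : f ^ 2 ≤ 1 := by rw [← sq_abs]; nlinarith [abs_nonneg f]
  have y : (p' * g * f) ^ 2 ≤ K ^ 2 * g ^ 2 := by
    calc (p' * g * f) ^ 2 = p' ^ 2 * g ^ 2 * f ^ 2 := by ring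
      _ ≤ K ^ 2 * g ^ 2 * 1 := by gcongr
      _ = _ := by ring
  have z : (p * h * f) ^ 2 ≤ h ^ 2 := by
    calc (p * h * f) ^ 2 = p ^ 2 * h ^ 2 * f ^ 2 := by ring
      _ ≤ 1 * h ^ 2 * 1 := by gcongr
      _ = _ := by ring
  nlinarith [sq_nonneg (p * g ^ 2 / 2 + 2 * (p' * g * f)),
    sq_nonneg (p * g ^ 2 / 2 + 3 * (p * h * f)), sq_nonneg g, mul_nonneg (sq_nonneg K) (sq_nonneg h)]

/-- First derivatives of a bounded function are in `L⁴` when the second ones are in `L²`. -/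
lemma quartic {r R : ℝ} (hr : 0 < r) (hrR : r < R) : ∃ C : ℝ, 0 ≤ C ∧
    ∀ f : ST → ℝ, ContDiff ℝ ∞ f → ∀ t, (∀ x ∈ ball (0 : E3) R, |f (t, x)| ≤ 1) → ∀ j,
      ∫ x in ball (0 : E3) r, dd (e j) f (t, x) ^ 4 ≤
        C * ∫ x in ball (0 : E3) R, (dd (e j) f (t, x) ^ 2 + dd (e j) (dd (e j) f) (t, x) ^ 2) := by
  obtain ⟨ψ, K, hψ⟩ := exists_cutoff hr hrR
  refine ⟨2 * (4 * K ^ 2 + 9), by positivity, fun f hf t hb j => ?_⟩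
  have hψs := hψ.smooth
  have hg := smooth_dd hf (e j)
  have hh := smooth_dd hg (e j)
  set g := dd (e j) f with hgdef
  let H : ST → ℝ := fun q => ψ q * ψ q * (g q * g q * g q * f q)
  have hH : ContDiff ℝ ∞ H := by fun_prop
  have hdH : dd (e j) H = fun q =>
      (dd (e j) ψ q * ψ q + ψ q * dd (e j) ψ q) * (g q * g q * g q * f q) + ψ q * ψ q *
        (((dd (e j) g q * g q + g q * dd (e j) g q) * g q + g q * g q * dd (e j) g q) * f q
          + g q * g q * g q * g q) := by
    simp only [H]
    rw [dd_mul (hψs.mul hψs) (((hg.mul hg).mul hg).mul hf), dd_mul hψs hψs,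
      dd_mul ((hg.mul hg).mul hg) hf, dd_mul (hg.mul hg) hg, dd_mul hg hg]
  have hint : ∫ x in ball (0 : E3) R, dd (e j) H (t, x) = 0 :=
    integral_dd_eq_zero hH (ρ := (r + R) / 2) (by linarith)
      (fun x hx => by simp [H, hψ.eq_zero t x hx]) j
  have c1 := continuous_slice (smooth_dd hH (e j)).continuous t
  have s2 : ContDiff ℝ ∞ fun q => g q ^ 2 + dd (e j) g q ^ 2 := by fun_prop
  have c2 := continuous_slice s2.continuous t
  have s3 : ContDiff ℝ ∞ fun q => ψ q ^ 2 * g q ^ 4 / 2 := by fun_prop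
  have c3 := continuous_slice s3.continuous t
  have c4 := continuous_slice (hg.pow 4).continuous t
  have hle : ∫ x in ball (0 : E3) R, ψ (t, x) ^ 2 * g (t, x) ^ 4 / 2 ≤
      ∫ x in ball (0 : E3) R, (dd (e j) H (t, x) +
        (4 * K ^ 2 + 9) * (g (t, x) ^ 2 + dd (e j) g (t, x) ^ 2)) := by
    refine integral_ball_mono c3 (by fun_prop) fun x hx => ?_
    rw [hdH]
    exact quartic_pointwise _ _ _ _ _ K (hψ.nonneg _) (hψ.le_one _) (hψ.dd_le _ _) (hb x hx)
  rw [integral_add (integrableOn_ball c1 R) (integrableOn_ball (by fun_prop) R), hint, zero_add,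
    integral_const_mul, integral_div] at hle
  have hle2 : ∫ x in ball (0 : E3) r, g (t, x) ^ 4 ≤
      ∫ x in ball (0 : E3) R, ψ (t, x) ^ 2 * g (t, x) ^ 4 := by
    have s5 : ContDiff ℝ ∞ fun q => ψ q ^ 2 * g q ^ 4 := by fun_prop
    have c5 := continuous_slice s5.continuous t
    refine le_trans (integral_ball_mono c4 c5 fun x hx => ?_)
      (integral_ball_mono_set c5 (fun x => by positivity) hrR.le)
    rw [hψ.eq_one t x hx]; simp
  linarith

lemma integral_cyl_le_of_slice {f g : ST → ℝ} (hf : Continuous f) (hg : Continuous g)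
    (hg0 : ∀ q, 0 ≤ g q) {r r' T C : ℝ} (hr : 0 ≤ r) (hrr : r ≤ r') (hC : 0 ≤ C)
    (h : ∀ t ∈ Icc (-r ^ 2) T, ∫ x in ball (0 : E3) r, f (t, x) ≤
      C * ∫ x in ball (0 : E3) r', g (t, x)) :
    ∫ q in cyl (-r ^ 2) T r, f q ≤ C * ∫ q in cyl (-r' ^ 2) T r', g q := by
  have h1 : ∫ q in cyl (-r ^ 2) T r, f q ≤ C * ∫ q in cyl (-r ^ 2) T r', g q := by
    rw [integral_cyl hf, integral_cyl hg, ← integral_const_mul]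
    exact setIntegral_mono_on (integrableOn_slice hf _ _ _)
      ((integrableOn_slice hg _ _ _).const_mul C) measurableSet_Icc h
  exact h1.trans (mul_le_mul_of_nonneg_left
    (integral_cyl_mono_set hg hg0 (by nlinarith) le_rfl le_rfl) hC)

lemma integral_sq_add_le {f g : ST → ℝ} (hf : Continuous f) (hg : Continuous g) (a b r : ℝ) :
    ∫ q in cyl a b r, (f q + g q) ^ 2 ≤
      2 * (∫ q in cyl a b r, f q ^ 2) + 2 * ∫ q in cyl a b r, g q ^ 2 := by
  rw [← integral_const_mul, ← integral_const_mul, ← integral_add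
    (integrableOn_cyl (by fun_prop) _ _ _) (integrableOn_cyl (by fun_prop) _ _ _)]
  exact integral_cyl_mono (by fun_prop) (by fun_prop) fun q _ => by
    nlinarith [sq_nonneg (f q - g q)]

lemma integral_sq_sub_le {f g : ST → ℝ} (hf : Continuous f) (hg : Continuous g) (a b r : ℝ) :
    ∫ q in cyl a b r, (f q - g q) ^ 2 ≤
      2 * (∫ q in cyl a b r, f q ^ 2) + 2 * ∫ q in cyl a b r, g q ^ 2 := by
  rw [← integral_const_mul, ← integral_const_mul, ← integral_add
    (integrableOn_cyl (by fun_prop) _ _ _) (integrableOn_cyl (by fun_prop) _ _ _)]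
  exact integral_cyl_mono (by fun_prop) (by fun_prop) fun q _ => by
    nlinarith [sq_nonneg (f q + g q)]

lemma integral_sq_sum_le {f : Fin 3 → ST → ℝ} (hf : ∀ i, Continuous (f i)) (a b r : ℝ) :
    ∫ q in cyl a b r, (∑ i, f i q) ^ 2 ≤ 3 * ∑ i, ∫ q in cyl a b r, f i q ^ 2 := by
  rw [← integral_finsetSum _ fun i _ => integrableOn_cyl (by fun_prop) _ _ _, ← integral_const_mul]
  refine integral_cyl_mono (by fun_prop) (by fun_prop) fun q _ => ?_
  simpa using sq_sum_le_card_mul_sum_sq (s := Finset.univ) (f := fun i => f i q)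

/-- An `L²` bound for a product, one factor being controlled in `L²_t H²_x` and the other in
`L^∞_t L²_x`. -/
lemma integral_sq_mul_le {r r' : ℝ} (hr : 0 < r) (hrr : r < r') : ∃ C : ℝ, 0 ≤ C ∧
    ∀ f g : ST → ℝ, ContDiff ℝ ∞ f → ContDiff ℝ ∞ g → ∀ T B : ℝ, 0 ≤ B →
      (∀ t ∈ Icc (-r ^ 2) T, ∫ x in ball (0 : E3) r, g (t, x) ^ 2 ≤ B) →
      ∫ q in cyl (-r ^ 2) T r, (f q * g q) ^ 2 ≤
        C * B * ∫ q in cyl (-r' ^ 2) T r', (f q ^ 2 + ∑ j, dd (e j) f q ^ 2 +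
          ∑ j, dd (e j) (dd (e j) f) q ^ 2) := by
  obtain ⟨C, hC0, hC⟩ := sobolev hr hrr
  refine ⟨C, hC0, fun f g hf hg T B hB hgB => ?_⟩
  have h1 := fun i => smooth_dd hf (e i)
  have h2 := fun i => smooth_dd (h1 i) (e i)
  let N : ST → ℝ := fun q => f q ^ 2 + ∑ j, dd (e j) f q ^ 2 + ∑ j, dd (e j) (dd (e j) f) q ^ 2
  have hN : ContDiff ℝ ∞ N := by fun_prop
  have hN0 : ∀ q, 0 ≤ N q := fun q => by
    have s1 : 0 ≤ ∑ j, dd (e j) f q ^ 2 := Finset.sum_nonneg fun j _ => sq_nonneg _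
    have s2 : 0 ≤ ∑ j, dd (e j) (dd (e j) f) q ^ 2 := Finset.sum_nonneg fun j _ => sq_nonneg _
    positivity
  have cg := hg.continuous
  refine integral_cyl_le_of_slice ((hf.mul hg).pow 2).continuous hN.continuous hN0 hr.le hrr.le
    (by positivity) fun t ht => ?_
  have hI : 0 ≤ ∫ x in ball (0 : E3) r', N (t, x) := integral_nonneg fun x => hN0 _
  have cg' := continuous_slice (hg.pow 2).continuous t
  calc ∫ x in ball (0 : E3) r, (f (t, x) * g (t, x)) ^ 2
      ≤ ∫ x in ball (0 : E3) r, (C * ∫ x in ball (0 : E3) r', N (t, x)) * g (t, x) ^ 2 := by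
        refine integral_ball_mono (continuous_slice ((hf.mul hg).pow 2).continuous t)
          (by fun_prop) fun x hx => ?_
        rw [mul_pow]
        exact mul_le_mul_of_nonneg_right (hC f hf t x hx) (sq_nonneg _)
    _ = (C * ∫ x in ball (0 : E3) r', N (t, x)) * ∫ x in ball (0 : E3) r, g (t, x) ^ 2 :=
        integral_const_mul _ _
    _ ≤ (C * ∫ x in ball (0 : E3) r', N (t, x)) * B := by
        gcongr
        exact hgB t ht
    _ = _ := by ring

/-- A smooth bounded solution of the Navier–Stokes equations on a neighbourhood of the cylinder
`[-R², T] × B_R`, with integrable pressure gradient. -/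
structure Adm (R T : ℝ) (v : Fin 3 → ST → ℝ) (p : ST → ℝ) : Prop where
  nonpos : T ≤ 0
  smooth : ∀ i, ContDiff ℝ ∞ (v i)
  smooth_p : ContDiff ℝ ∞ p
  eqn : ∀ t ∈ Icc (-R ^ 2) T, ∀ x ∈ ball (0 : E3) R, ∀ i, dd tt (v i) (t, x) =
    ∑ j, dd (e j) (dd (e j) (v i)) (t, x) - ∑ j, v j (t, x) * dd (e j) (v i) (t, x)
      - dd (e i) p (t, x)
  div_free : ∀ t ∈ Icc (-R ^ 2) T, ∀ x ∈ ball (0 : E3) R, ∑ i, dd (e i) (v i) (t, x) = 0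
  bounded : ∀ t ∈ Icc (-R ^ 2) T, ∀ x ∈ ball (0 : E3) R, ∀ i, |v i (t, x)| ≤ 1
  pressure : ∀ i, ∫ q in cyl (-R ^ 2) T R, |dd (e i) p q| ≤ 1

/-- Derivatives of order `k` are bounded in `L^∞_t L²_x` on interior cylinders. -/
def SliceBound (R : ℝ) (k : ℕ) : Prop := ∀ r, 0 < r → r < R → ∃ C : ℝ, 0 ≤ C ∧
  ∀ T v p, Adm R T v p → ∀ l : List (Fin 3), l.length = k → ∀ i, ∀ t ∈ Icc (-r ^ 2) T,
    ∫ x in ball (0 : E3) r, D l (v i) (t, x) ^ 2 ≤ C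

/-- Derivatives of order `k` are bounded in `L²_t L²_x` on interior cylinders. -/
def CylBound (R : ℝ) (k : ℕ) : Prop := ∀ r, 0 < r → r < R → ∃ C : ℝ, 0 ≤ C ∧
  ∀ T v p, Adm R T v p → ∀ l : List (Fin 3), l.length = k → ∀ i,
    ∫ q in cyl (-r ^ 2) T r, D l (v i) q ^ 2 ≤ C

lemma Icc_subset_of_lt {r R T : ℝ} (hr : 0 < r) (hrR : r < R) :
    Icc (-r ^ 2) T ⊆ Icc (-R ^ 2) T := Icc_subset_Icc (by nlinarith) le_rfl

lemma integral_cyl_one_mono {r R T : ℝ} (hr : 0 < r) (hrR : r ≤ R) (hT : T ≤ 0) :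
    ∫ _q in cyl (-r ^ 2) T r, (1 : ℝ) ≤ ∫ _q in cyl (-R ^ 2) 0 R, (1 : ℝ) :=
  integral_cyl_mono_set continuous_const (fun _ => zero_le_one) (by nlinarith) hT hrR

lemma sliceBound_zero (R : ℝ) : SliceBound R 0 := by
  intro r hr hrR
  refine ⟨∫ _x in ball (0 : E3) r, (1 : ℝ), integral_nonneg fun _ => zero_le_one,
    fun T v p h l hl i t ht => ?_⟩
  rw [List.length_eq_zero_iff] at hl
  subst hl
  refine integral_ball_mono (continuous_slice ((h.smooth i).pow 2).continuous t)
    continuous_const fun x hx => ?_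
  have hb := h.bounded t (Icc_subset_of_lt hr hrR ht) x (ball_subset_ball hrR.le hx) i
  simpa [D] using hb

lemma cylBound_zero (R : ℝ) : CylBound R 0 := by
  intro r hr hrR
  refine ⟨∫ _q in cyl (-R ^ 2) 0 R, (1 : ℝ), integral_nonneg fun _ => zero_le_one,
    fun T v p h l hl i => ?_⟩
  rw [List.length_eq_zero_iff] at hl
  subst hl
  refine le_trans (integral_cyl_mono ((h.smooth i).pow 2).continuous
    continuous_const fun q hq => ?_) (integral_cyl_one_mono hr hrR.le h.nonpos)
  have hb := h.bounded q.1 (Icc_subset_of_lt hr hrR hq.1) q.2 (ball_subset_ball hrR.le hq.2) i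
  simpa [D] using hb

lemma cylBound_one {R : ℝ} (hR : 0 < R) : CylBound R 1 := by
  intro r hr hrR
  obtain ⟨C, hC0, hC⟩ := energy hr hrR
  refine ⟨C * (4 * (∫ _q in cyl (-R ^ 2) 0 R, (1 : ℝ)) + 1),
    mul_nonneg hC0 (add_nonneg (mul_nonneg (by norm_num)
      (integral_nonneg fun _ => zero_le_one)) zero_le_one), fun T v p h l hl i => ?_⟩
  obtain ⟨j, rfl⟩ := List.length_eq_one_iff.1 hl
  have hv := h.smooth
  have hv1 := fun i j => smooth_dd (hv i) (e j)
  have hp := smooth_dd h.smooth_p (e i)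
  have key := (hC (v i) (fun q => - dd (e i) p q) (fun j q => - (v j q * v i q)) T h.nonpos (hv i)
    (fun j => by fun_prop) hp.neg (fun t ht x hx => by
      rw [h.eqn t ht x hx i]
      have hd : ∀ j, dd (e j) (fun q => -(v j q * v i q)) (t, x) =
          - (dd (e j) (v j) (t, x) * v i (t, x) + v j (t, x) * dd (e j) (v i) (t, x)) := fun j => by
        rw [dd_neg (fun q => v j q * v i q), dd_mul (hv j) (hv i)]
      simp only [hd, Finset.sum_add_distrib, Finset.sum_neg_distrib, ← Finset.sum_mul,
        h.div_free t ht x hx]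
      ring)).2
  refine le_trans (integral_cyl_mono (by
    have : ContDiff ℝ ∞ (fun q => D [j] (v i) q ^ 2) := (smooth_D _ (hv i)).pow 2
    exact this.continuous) (by
    have : ContDiff ℝ ∞ (fun q => ∑ j, dd (e j) (v i) q ^ 2) := by fun_prop
    exact this.continuous) fun q _ => ?_) (key.trans (mul_le_mul_of_nonneg_left ?_ hC0))
  · exact Finset.single_le_sum (f := fun j => dd (e j) (v i) q ^ 2) (fun j _ => sq_nonneg _)
          (Finset.mem_univ j)
  · have c1 : Continuous fun q => v i q ^ 2 + ∑ j, (-(v j q * v i q)) ^ 2 + |v i q * -dd (e i) p q| := by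
      have : ContDiff ℝ ∞ fun q => v i q ^ 2 + ∑ j, (-(v j q * v i q)) ^ 2 := by fun_prop
      exact this.continuous.add ((hv i).mul hp.neg).continuous.abs
    have c2 : Continuous fun q => |dd (e i) p q| := hp.continuous.abs
    refine le_trans (integral_cyl_mono (g := fun q => 4 * 1 + |dd (e i) p q|) c1 (by fun_prop)
      fun q hq => ?_) ?_
    · have hb := fun j => h.bounded q.1 hq.1 q.2 hq.2 j
      have hb2 : ∀ j, v j q ^ 2 ≤ 1 := fun j => by simpa using hb j
      have hb3 : ∀ j, (-(v j q * v i q)) ^ 2 ≤ 1 := fun j => by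
        rw [neg_sq, mul_pow]
        exact mul_le_one₀ (hb2 j) (sq_nonneg _) (hb2 i)
      have s1 : ∑ j, (-(v j q * v i q)) ^ 2 ≤ ∑ _j : Fin 3, (1 : ℝ) :=
        Finset.sum_le_sum fun j _ => hb3 j
      have s2 : |v i q * -dd (e i) p q| ≤ 1 * |dd (e i) p q| := by
        rw [abs_mul, abs_neg]
        exact mul_le_mul_of_nonneg_right (hb i) (abs_nonneg _)
      simp only [Finset.sum_const, Finset.card_univ, Fintype.card_fin, nsmul_eq_mul] at s1
      push_cast at s1
      linarith [hb2 i]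
    · rw [integral_add (integrableOn_cyl continuous_const _ _ _) (integrableOn_cyl c2 _ _ _),
        integral_const_mul]
      have := integral_cyl_one_mono hR le_rfl h.nonpos
      linarith [h.pressure i]

/-- Caccioppoli's inequality for the div-curl system satisfied by derivatives of the velocity. -/
lemma div_curl {r r' R : ℝ} (hr : 0 < r) (hrr : r < r') (hR : r' < R) : ∃ C : ℝ, 0 ≤ C ∧
    ∀ T v p, Adm R T v p → ∀ (l : List (Fin 3)) (j : Fin 3), ∀ t ∈ Icc (-r' ^ 2) T,
      ∫ x in ball (0 : E3) r, ∑ i, D (i :: l) (v j) (t, x) ^ 2 ≤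
        C * ∫ x in ball (0 : E3) r', (D l (v j) (t, x) ^ 2 +
          ∑ i, (D (i :: l) (v j) (t, x) - D (j :: l) (v i) (t, x)) ^ 2) := by
  obtain ⟨C, hC0, hC⟩ := caccioppoli hr hrr
  refine ⟨C, hC0, fun T v p h l j t ht => ?_⟩
  have hv := h.smooth
  have hD := fun l i => smooth_D l (hv i)
  have hw := hD l j
  have key := hC (D l (v j)) (fun i q => - (D (i :: l) (v j) q - D (j :: l) (v i) q)) (hD l j)
    (fun i => ((hD _ _).sub (hD _ _)).neg) t (fun x hx => by
      have h0 := D_congr (j :: l) (f := fun q => ∑ i, dd (e i) (v i) q) (g := fun _ => 0)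
        (ContDiff.sum fun i _ => smooth_dd (hv i) _) contDiff_const isOpen_ball
        (h.div_free t (Icc_subset_of_lt (hr.trans hrr) hR ht)) x (ball_subset_ball hR.le hx)
      rw [D_sum (j :: l) _ (fun i => smooth_dd (hv i) _), D_zero] at h0
      have h1 : ∀ i, dd (e i) (fun q => - (D (i :: l) (v j) q - D (j :: l) (v i) q)) (t, x) =
          D (j :: l) (dd (e i) (v i)) (t, x) - dd (e i) (dd (e i) (D l (v j))) (t, x) := fun i => by
        rw [dd_neg (fun q => D (i :: l) (v j) q - D (j :: l) (v i) q), dd_sub (hD _ _) (hD _ _),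
          D_dd _ (hv i), D_cons l (hv j) i]
        ring
      simp only [h1]
      simpa using h0)
  simpa only [D_cons l (hv j), neg_sq] using key

lemma integral_sq_mul_bound_of_sup {R : ℝ} {s g : ℕ} (h0 : CylBound R s) (h1 : CylBound R (s + 1))
    (h2 : CylBound R (s + 2)) (hg : SliceBound R g) :
    ∀ r, 0 < r → r < R → ∃ C : ℝ, 0 ≤ C ∧ ∀ T v p, Adm R T v p → ∀ a b : List (Fin 3),
      a.length = s → b.length = g → ∀ m j,
        ∫ q in cyl (-r ^ 2) T r, (D a (v m) q * D b (v j) q) ^ 2 ≤ C := by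
  intro r hr hrR
  have hrr : r < (r + R) / 2 := by linarith
  have hrr' : (r + R) / 2 < R := by linarith
  obtain ⟨C, hC0, hC⟩ := integral_sq_mul_le hr hrr
  obtain ⟨B, hB0, hB⟩ := hg r hr hrR
  obtain ⟨A0, hA0', hA0⟩ := h0 _ (by linarith) hrr'
  obtain ⟨A1, hA1', hA1⟩ := h1 _ (by linarith) hrr'
  obtain ⟨A2, hA2', hA2⟩ := h2 _ (by linarith) hrr'
  refine ⟨C * B * (A0 + 3 * A1 + 3 * A2), by positivity, fun T v p h a b ha hb m j => ?_⟩
  have hf := smooth_D a (h.smooth m)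
  have hf1 := fun i => smooth_dd hf (e i)
  have hf2 := fun i => smooth_dd (hf1 i) (e i)
  refine (hC _ _ hf (smooth_D b (h.smooth j)) T B hB0 (hB T v p h b hb j)).trans ?_
  refine mul_le_mul_of_nonneg_left ?_ (by positivity)
  have i0 : ∀ {f : ST → ℝ}, ContDiff ℝ ∞ f →
      IntegrableOn f (cyl (-((r + R) / 2) ^ 2) T ((r + R) / 2)) := fun hf =>
    integrableOn_cyl hf.continuous _ _ _
  rw [integral_add (i0 (by fun_prop)) (i0 (by fun_prop)), integral_add (i0 (by fun_prop))
    (i0 (by fun_prop)), integral_finsetSum _ fun i _ => i0 (by fun_prop),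
    integral_finsetSum _ fun i _ => i0 (by fun_prop)]
  have s1 := Finset.sum_le_sum fun i (_ : i ∈ (Finset.univ : Finset (Fin 3))) =>
    hA1 T v p h (i :: a) (by simp [ha]) m
  have s2 := Finset.sum_le_sum fun i (_ : i ∈ (Finset.univ : Finset (Fin 3))) =>
    hA2 T v p h (i :: i :: a) (by simp [ha]) m
  simp only [D_cons _ (h.smooth m), Finset.sum_const, Finset.card_univ, Fintype.card_fin,
    nsmul_eq_mul, Nat.cast_ofNat] at s1 s2
  have s0 := hA0 T v p h a ha m
  linarith

lemma integral_sq_mul_bound_of_one {R : ℝ} (h1 : CylBound R 1) (h2 : CylBound R 2) :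
    ∀ r, 0 < r → r < R → ∃ C : ℝ, 0 ≤ C ∧ ∀ T v p, Adm R T v p → ∀ a b : List (Fin 3),
      a.length = 1 → b.length = 1 → ∀ m j,
        ∫ q in cyl (-r ^ 2) T r, (D a (v m) q * D b (v j) q) ^ 2 ≤ C := by
  intro r hr hrR
  have hrr : r < (r + R) / 2 := by linarith
  have hrr' : (r + R) / 2 < R := by linarith
  obtain ⟨C, hC0, hC⟩ := quartic hr hrr
  obtain ⟨A1, hA1', hA1⟩ := h1 _ (by linarith) hrr'
  obtain ⟨A2, hA2', hA2⟩ := h2 _ (by linarith) hrr'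
  refine ⟨C * (A1 + A2), by positivity, fun T v p h a b ha hb m j => ?_⟩
  obtain ⟨a, rfl⟩ := List.length_eq_one_iff.1 ha
  obtain ⟨b, rfl⟩ := List.length_eq_one_iff.1 hb
  have h4 : ∀ i m, ∫ q in cyl (-r ^ 2) T r, D [i] (v m) q ^ 4 ≤ C * (A1 + A2) := fun i m => by
    have hv1 := smooth_dd (h.smooth m) (e i)
    have hv2 := smooth_dd hv1 (e i)
    have hN : ContDiff ℝ ∞ fun q => dd (e i) (v m) q ^ 2 + dd (e i) (dd (e i) (v m)) q ^ 2 := by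
      fun_prop
    refine (integral_cyl_le_of_slice (hv1.pow 4).continuous hN.continuous
      (fun q => by positivity) hr.le hrr.le hC0 fun t ht => hC (v m) (h.smooth m) t
        (fun x hx => ?_) i).trans (mul_le_mul_of_nonneg_left ?_ hC0)
    · exact h.bounded t (Icc_subset_of_lt hr hrR ht) x (ball_subset_ball hrr'.le hx) m
    · rw [integral_add (integrableOn_cyl (hv1.pow 2).continuous _ _ _)
        (integrableOn_cyl (hv2.pow 2).continuous _ _ _)]
      exact add_le_add (hA1 T v p h [i] rfl m) (hA2 T v p h [i, i] rfl m)
  have ca := (smooth_D [a] (h.smooth m)).continuous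
  have cb := (smooth_D [b] (h.smooth j)).continuous
  have hle : ∫ q in cyl (-r ^ 2) T r, (D [a] (v m) q * D [b] (v j) q) ^ 2 ≤
      ∫ q in cyl (-r ^ 2) T r, (D [a] (v m) q ^ 4 / 2 + D [b] (v j) q ^ 4 / 2) :=
    integral_cyl_mono (by fun_prop) (by fun_prop) fun q _ => by
      nlinarith [sq_nonneg (D [a] (v m) q ^ 2 - D [b] (v j) q ^ 2)]
  rw [integral_add (integrableOn_cyl (by fun_prop) _ _ _) (integrableOn_cyl (by fun_prop) _ _ _),
    integral_div, integral_div] at hle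
  linarith [h4 a m, h4 b j]

lemma integral_sq_mul_bound {R : ℝ} {k : ℕ} (hS : ∀ j ≤ k, SliceBound R j)
    (hB : ∀ j ≤ k + 1, CylBound R j) {m n : ℕ} (hn : 1 ≤ n) (hmn : m + n = k + 1) :
    ∀ r, 0 < r → r < R → ∃ C : ℝ, 0 ≤ C ∧ ∀ T v p, Adm R T v p → ∀ a b : List (Fin 3),
      a.length = m → b.length = n → ∀ i j,
        ∫ q in cyl (-r ^ 2) T r, (D a (v i) q * D b (v j) q) ^ 2 ≤ C := by
  rcases Nat.eq_zero_or_pos m with rfl | hm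
  · intro r hr hrR
    obtain ⟨C, hC0, hC⟩ := hB n (by omega) r hr hrR
    refine ⟨C, hC0, fun T v p h a b ha hb i j => ?_⟩
    rw [List.length_eq_zero_iff] at ha
    subst ha
    have cb := (smooth_D b (h.smooth j)).continuous
    refine le_trans (integral_cyl_mono ?_ (cb.pow 2) fun q hq => ?_) (hC T v p h b hb j)
    · exact ((h.smooth i).continuous.mul cb).pow 2
    · have hbd : v i q ^ 2 ≤ 1 := by
        simpa using h.bounded q.1 (Icc_subset_of_lt hr hrR hq.1) q.2
          (ball_subset_ball hrR.le hq.2) i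
      rw [mul_pow]
      exact mul_le_of_le_one_left (sq_nonneg _) hbd
  · by_cases h1 : m = 1 ∧ n = 1
    · obtain ⟨rfl, rfl⟩ := h1
      exact integral_sq_mul_bound_of_one (hB 1 (by omega)) (hB 2 (by omega))
    · rcases le_or_gt m n with hle | hlt
      · exact integral_sq_mul_bound_of_sup (hB m (by omega)) (hB (m + 1) (by omega))
          (hB (m + 2) (by omega)) (hS n (by omega))
      · intro r hr hrR
        obtain ⟨C, hC0, hC⟩ := integral_sq_mul_bound_of_sup (hB n (by omega))
          (hB (n + 1) (by omega)) (hB (n + 2) (by omega)) (hS m (by omega)) r hr hrR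
        refine ⟨C, hC0, fun T v p h a b ha hb i j => ?_⟩
        simpa only [mul_comm] using hC T v p h b a hb ha j i

lemma integral_sq_D_mul_bound {R : ℝ} {k : ℕ} (hS : ∀ j ≤ k, SliceBound R j)
    (hB : ∀ j ≤ k + 1, CylBound R j) (s : ℕ) : ∀ {m n : ℕ}, 1 ≤ n → m + n + s = k + 1 →
    ∀ r, 0 < r → r < R → ∃ C : ℝ, 0 ≤ C ∧ ∀ T v p, Adm R T v p → ∀ l a b : List (Fin 3),
      l.length = s → a.length = m → b.length = n → ∀ i j,
        ∫ q in cyl (-r ^ 2) T r, D l (fun q => D a (v i) q * D b (v j) q) q ^ 2 ≤ C := by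
  induction s with
  | zero =>
    intro m n hn hmn r hr hrR
    obtain ⟨C, hC0, hC⟩ := integral_sq_mul_bound hS hB hn hmn r hr hrR
    refine ⟨C, hC0, fun T v p h l a b hl ha hb i j => ?_⟩
    rw [List.length_eq_zero_iff] at hl
    subst hl
    exact hC T v p h a b ha hb i j
  | succ s ih =>
    intro m n hn hmn r hr hrR
    obtain ⟨C, hC0, hC⟩ := ih (m := m + 1) hn (by omega) r hr hrR
    obtain ⟨C', hC0', hC'⟩ := ih (m := m) (n := n + 1) (by omega) (by omega) r hr hrR
    refine ⟨2 * C + 2 * C', by positivity, fun T v p h l a b hl ha hb i j => ?_⟩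
    obtain ⟨c, l, rfl⟩ := List.exists_cons_of_length_eq_add_one hl
    have hl' : l.length = s := by simpa using hl
    have hDa := smooth_D a (h.smooth i)
    have hDb := smooth_D b (h.smooth j)
    have hDa' := smooth_D (c :: a) (h.smooth i)
    have hDb' := smooth_D (c :: b) (h.smooth j)
    have e1 : D (c :: l) (fun q => D a (v i) q * D b (v j) q) = fun q =>
        D l (fun q => D (c :: a) (v i) q * D b (v j) q) q +
          D l (fun q => D a (v i) q * D (c :: b) (v j) q) q := by
      change D l (dd (e c) _) = _
      rw [dd_mul hDa hDb, ← D_cons _ (h.smooth i), ← D_cons _ (h.smooth j),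
        D_add l (hDa'.mul hDb) (hDa.mul hDb')]
    rw [e1]
    refine (integral_sq_add_le (smooth_D l (hDa'.mul hDb)).continuous
      (smooth_D l (hDa.mul hDb')).continuous _ _ _).trans ?_
    have b1 := hC T v p h l (c :: a) b hl' (by simp [ha]) hb i j
    have b2 := hC' T v p h l a (c :: b) hl' ha (by simp [hb]) i j
    linarith

/-- The convective term `(v · ∇) v_j`. -/
def convect (v : Fin 3 → ST → ℝ) (j : Fin 3) (q : ST) : ℝ := ∑ m, v m q * dd (e m) (v j) q

lemma smooth_convect {v : Fin 3 → ST → ℝ} (hv : ∀ i, ContDiff ℝ ∞ (v i)) (j : Fin 3) :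
    ContDiff ℝ ∞ (convect v j) :=
  ContDiff.sum fun m _ => (hv m).mul (smooth_dd (hv j) _)

lemma integral_sq_convect_bound {R : ℝ} {k : ℕ} (hS : ∀ j ≤ k, SliceBound R j)
    (hB : ∀ j ≤ k + 1, CylBound R j) :
    ∀ r, 0 < r → r < R → ∃ C : ℝ, 0 ≤ C ∧ ∀ T v p, Adm R T v p → ∀ l : List (Fin 3),
      l.length = k → ∀ j, ∫ q in cyl (-r ^ 2) T r, D l (convect v j) q ^ 2 ≤ C := by
  intro r hr hrR
  obtain ⟨C, hC0, hC⟩ := integral_sq_D_mul_bound hS hB k (m := 0) (n := 1) le_rfl (by omega)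
    r hr hrR
  refine ⟨9 * C, by positivity, fun T v p h l hl j => ?_⟩
  have hs : ∀ m, ContDiff ℝ ∞ fun q => v m q * dd (e m) (v j) q := fun m =>
    (h.smooth m).mul (smooth_dd (h.smooth j) _)
  have e1 : D l (convect v j) = fun q => ∑ m, D l (fun q => v m q * dd (e m) (v j) q) q :=
    D_sum l _ hs
  rw [e1]
  refine (integral_sq_sum_le (fun m => (smooth_D l (hs m)).continuous) _ _ _).trans ?_
  have := Finset.sum_le_sum fun m (_ : m ∈ (Finset.univ : Finset (Fin 3))) =>
    hC T v p h l [] [m] hl rfl rfl m j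
  simp only [Finset.sum_const, Finset.card_univ, Fintype.card_fin, nsmul_eq_mul, Nat.cast_ofNat]
    at this
  have e2 : ∀ m, ∫ q in cyl (-r ^ 2) T r, D l (fun q => v m q * dd (e m) (v j) q) q ^ 2 =
    ∫ q in cyl (-r ^ 2) T r, D l (fun q => D [] (v m) q * D [m] (v j) q) q ^ 2 := fun m => rfl
  simp only [e2]
  linarith

/-- The derivative `∂^l` of the vorticity component `∂_i v_j - ∂_j v_i`. -/
def vort (v : Fin 3 → ST → ℝ) (l : List (Fin 3)) (i j : Fin 3) (q : ST) : ℝ :=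
  D (i :: l) (v j) q - D (j :: l) (v i) q

lemma smooth_vort {v : Fin 3 → ST → ℝ} (hv : ∀ i, ContDiff ℝ ∞ (v i)) (l : List (Fin 3))
    (i j : Fin 3) : ContDiff ℝ ∞ (vort v l i j) :=
  (smooth_D _ (hv j)).sub (smooth_D _ (hv i))

lemma dd_vort {v : Fin 3 → ST → ℝ} (hv : ∀ i, ContDiff ℝ ∞ (v i)) (l : List (Fin 3))
    (i j m : Fin 3) : dd (e m) (vort v l i j) = vort v (m :: l) i j := by
  have e1 : ∀ i j, dd (e m) (D (i :: l) (v j)) = D (i :: m :: l) (v j) := fun i j => by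
    rw [← D_dd _ (hv j)]
    exact congrArg (D l) (dd_comm (hv j) _ _)
  have e2 : dd (e m) (vort v l i j) = fun q =>
      dd (e m) (D (i :: l) (v j)) q - dd (e m) (D (j :: l) (v i)) q :=
    dd_sub (smooth_D _ (hv j)) (smooth_D _ (hv i)) _
  rw [e2, e1, e1]
  rfl

lemma dd_const_mul {f : ST → ℝ} (hf : ContDiff ℝ ∞ f) (c : ℝ) (a : ST) :
    dd a (fun q => c * f q) = fun q => c * dd a f q := by
  rw [dd_mul contDiff_const hf]
  ext q
  simp [dd]

/-- The flux in the vorticity equation. -/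
def flux (v : Fin 3 → ST → ℝ) (l : List (Fin 3)) (i j m : Fin 3) (q : ST) : ℝ :=
  (if m = j then 1 else 0) * D l (convect v i) q - (if m = i then 1 else 0) * D l (convect v j) q

lemma smooth_flux {v : Fin 3 → ST → ℝ} (hv : ∀ i, ContDiff ℝ ∞ (v i)) (l : List (Fin 3))
    (i j m : Fin 3) : ContDiff ℝ ∞ (flux v l i j m) :=
  (contDiff_const.mul (smooth_D _ (smooth_convect hv i))).sub
    (contDiff_const.mul (smooth_D _ (smooth_convect hv j)))

lemma sum_dd_flux {v : Fin 3 → ST → ℝ} (hv : ∀ i, ContDiff ℝ ∞ (v i)) (l : List (Fin 3))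
    (i j : Fin 3) (q : ST) : ∑ m, dd (e m) (flux v l i j m) q =
      dd (e j) (D l (convect v i)) q - dd (e i) (D l (convect v j)) q := by
  have e1 : ∀ m, dd (e m) (flux v l i j m) q =
      (if m = j then 1 else 0) * dd (e m) (D l (convect v i)) q -
        (if m = i then 1 else 0) * dd (e m) (D l (convect v j)) q := fun m => by
    have h1 := smooth_D l (smooth_convect hv i)
    have h2 := smooth_D l (smooth_convect hv j)
    have := dd_sub (contDiff_const.mul h1 : ContDiff ℝ ∞ fun q =>
      (if m = j then (1 : ℝ) else 0) * D l (convect v i) q) (contDiff_const.mul h2 :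
      ContDiff ℝ ∞ fun q => (if m = i then (1 : ℝ) else 0) * D l (convect v j) q) (e m)
    rw [dd_const_mul h1, dd_const_mul h2] at this
    exact congrFun this q
  simp [e1, Finset.sum_sub_distrib]

lemma velocity_eqn {R T : ℝ} {v : Fin 3 → ST → ℝ} {p : ST → ℝ} (h : Adm R T v p)
    (l : List (Fin 3)) (i j : Fin 3) {t : ℝ} (ht : t ∈ Icc (-R ^ 2) T) {x : E3}
    (hx : x ∈ ball (0 : E3) R) : dd tt (D (i :: l) (v j)) (t, x) =
      ∑ m, dd (e m) (dd (e m) (D (i :: l) (v j))) (t, x) - dd (e i) (D l (convect v j)) (t, x)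
        - D l (dd (e i) (dd (e j) p)) (t, x) := by
  have hv := h.smooth
  have hv1 := fun m => smooth_dd (hv j) (e m)
  have hv2 := fun m => smooth_dd (hv1 m) (e m)
  have hc := smooth_convect hv j
  have hp := smooth_dd h.smooth_p (e j)
  have hs : ContDiff ℝ ∞ fun q => ∑ m, dd (e m) (dd (e m) (v j)) q := by fun_prop
  have h0 := D_congr (i :: l) (f := dd tt (v j))
    (g := fun q => ∑ m, dd (e m) (dd (e m) (v j)) q - convect v j q - dd (e j) p q)
    (smooth_dd (hv j) _) ((hs.sub hc).sub hp) isOpen_ball (fun x hx => h.eqn t ht x hx j) x hx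
  rw [D_dd _ (hv j), D_sub _ (hs.sub hc) hp, D_sub _ hs hc, D_sum _ _ hv2] at h0
  rw [h0]
  simp only [D_dd _ (hv1 _), D_dd _ (hv j), D_cons l hc]
  rfl

lemma vorticity_eqn {R T : ℝ} {v : Fin 3 → ST → ℝ} {p : ST → ℝ} (h : Adm R T v p)
    (l : List (Fin 3)) (i j : Fin 3) {t : ℝ} (ht : t ∈ Icc (-R ^ 2) T) {x : E3}
    (hx : x ∈ ball (0 : E3) R) : dd tt (vort v l i j) (t, x) =
      ∑ m, (dd (e m) (dd (e m) (vort v l i j)) (t, x) + dd (e m) (flux v l i j m) (t, x))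
        + (0 : ℝ) := by
  have hv := h.smooth
  have hD := fun i j => smooth_D (i :: l) (hv j)
  have e1 : ∀ a : ST, dd a (vort v l i j) = fun q =>
      dd a (D (i :: l) (v j)) q - dd a (D (j :: l) (v i)) q := fun a => dd_sub (hD i j) (hD j i) a
  have e2 : ∀ m, dd (e m) (dd (e m) (vort v l i j)) = fun q =>
      dd (e m) (dd (e m) (D (i :: l) (v j))) q - dd (e m) (dd (e m) (D (j :: l) (v i))) q :=
    fun m => by rw [e1, dd_sub (smooth_dd (hD i j) _) (smooth_dd (hD j i) _)]
  have e3 : dd (e j) (dd (e i) p) = dd (e i) (dd (e j) p) := dd_comm h.smooth_p _ _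
  rw [e1 tt]
  simp only [Finset.sum_add_distrib, sum_dd_flux hv, e2, velocity_eqn h l _ _ ht hx, e3,
    Finset.sum_sub_distrib]
  ring

lemma vort_bound {R : ℝ} {k : ℕ} (hS : ∀ j ≤ k, SliceBound R j)
    (hB : ∀ j ≤ k + 1, CylBound R j) :
    ∀ r, 0 < r → r < R → ∃ C : ℝ, 0 ≤ C ∧ ∀ T v p, Adm R T v p → ∀ l : List (Fin 3),
      l.length = k → ∀ i j, (∀ t ∈ Icc (-r ^ 2) T,
        ∫ x in ball (0 : E3) r, vort v l i j (t, x) ^ 2 ≤ C) ∧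
        ∫ q in cyl (-r ^ 2) T r, ∑ m, vort v (m :: l) i j q ^ 2 ≤ C := by
  intro r hr hrR
  have hrr : r < (r + R) / 2 := by linarith
  have hrr' : (r + R) / 2 < R := by linarith
  obtain ⟨C, hC0, hC⟩ := energy hr hrr
  obtain ⟨A, hA0, hA⟩ := hB (k + 1) le_rfl _ (by linarith) hrr'
  obtain ⟨B, hB0, hB⟩ := integral_sq_convect_bound hS hB _ (by linarith) hrr'
  refine ⟨C * (4 * A + 12 * B), by positivity, fun T v p h l hl i j => ?_⟩
  have hv := h.smooth
  have hw := smooth_vort hv l i j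
  have hG := smooth_flux hv l i j
  have hF := fun j => smooth_D l (smooth_convect hv j)
  have key := hC (vort v l i j) (fun _ => 0) (flux v l i j) T h.nonpos hw hG contDiff_const
    fun t ht x hx => vorticity_eqn h l i j (Icc_subset_of_lt (by linarith) hrr' ht)
      (ball_subset_ball hrr'.le hx)
  simp only [mul_zero, abs_zero, add_zero, dd_vort hv] at key
  set ρ := (r + R) / 2
  have hw2 : ∫ q in cyl (-ρ ^ 2) T ρ, vort v l i j q ^ 2 ≤ 4 * A := by
    have := integral_sq_sub_le (smooth_D (i :: l) (hv j)).continuous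
      (smooth_D (j :: l) (hv i)).continuous (-ρ ^ 2) T ρ
    have a1 := hA T v p h (i :: l) (by simp [hl]) j
    have a2 := hA T v p h (j :: l) (by simp [hl]) i
    simp only [vort]
    linarith
  have hG2 : ∀ m, ∫ q in cyl (-ρ ^ 2) T ρ, flux v l i j m q ^ 2 ≤ 4 * B := fun m => by
    have b1 := hB T v p h l hl i
    have b2 := hB T v p h l hl j
    have c1 := (hF i).continuous
    have c2 := (hF j).continuous
    have hle : ∫ q in cyl (-ρ ^ 2) T ρ, flux v l i j m q ^ 2 ≤ ∫ q in cyl (-ρ ^ 2) T ρ,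
        (2 * D l (convect v i) q ^ 2 + 2 * D l (convect v j) q ^ 2) := by
      refine integral_cyl_mono ((hG m).pow 2).continuous (by fun_prop) fun q _ => ?_
      simp only [flux]
      split_ifs <;> nlinarith [sq_nonneg (D l (convect v i) q + D l (convect v j) q),
        sq_nonneg (D l (convect v i) q), sq_nonneg (D l (convect v j) q)]
    rw [integral_add (integrableOn_cyl (by fun_prop) _ _ _) (integrableOn_cyl (by fun_prop) _ _ _),
      integral_const_mul, integral_const_mul] at hle
    linarith
  have hM : ∫ q in cyl (-ρ ^ 2) T ρ, (vort v l i j q ^ 2 + ∑ m, flux v l i j m q ^ 2) ≤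
      4 * A + 12 * B := by
    have i0 : ∀ {f : ST → ℝ}, ContDiff ℝ ∞ f → IntegrableOn f (cyl (-ρ ^ 2) T ρ) := fun hf =>
      integrableOn_cyl hf.continuous _ _ _
    rw [integral_add (i0 (by fun_prop)) (i0 (by fun_prop)),
      integral_finsetSum _ fun i _ => i0 (by fun_prop)]
    have s1 := Finset.sum_le_sum fun m (_ : m ∈ (Finset.univ : Finset (Fin 3))) => hG2 m
    simp only [Finset.sum_const, Finset.card_univ, Fintype.card_fin, nsmul_eq_mul,
      Nat.cast_ofNat] at s1
    linarith
  have hM' := mul_le_mul_of_nonneg_left hM hC0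
  exact ⟨fun t ht => (key.1 t ht).trans hM', key.2.trans hM'⟩

lemma sliceBound_succ {R : ℝ} {k : ℕ} (hS : ∀ j ≤ k, SliceBound R j)
    (hB : ∀ j ≤ k + 1, CylBound R j) : SliceBound R (k + 1) := by
  intro r hr hrR
  have hrr : r < (r + R) / 2 := by linarith
  have hrr' : (r + R) / 2 < R := by linarith
  obtain ⟨C, hC0, hC⟩ := div_curl hr hrr hrr'
  obtain ⟨A, hA0, hA⟩ := hS k le_rfl _ (by linarith) hrr'
  obtain ⟨B, hB0, hB⟩ := vort_bound hS hB _ (by linarith) hrr'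
  refine ⟨C * (A + 3 * B), by positivity, fun T v p h l hl j t ht => ?_⟩
  obtain ⟨i, l, rfl⟩ := List.exists_cons_of_length_eq_add_one hl
  have hl' : l.length = k := by simpa using hl
  have hv := h.smooth
  have ht' := Icc_subset_of_lt hr hrr ht
  set ρ := (r + R) / 2
  have hD := fun i => smooth_D (i :: l) (hv j)
  have hD0 := smooth_D l (hv j)
  have hw := fun i => smooth_vort hv l i j
  have s1 : ContDiff ℝ ∞ fun q => ∑ i, D (i :: l) (v j) q ^ 2 := by fun_prop
  refine (integral_ball_mono (continuous_slice ((hD i).pow 2).continuous t)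
    (continuous_slice s1.continuous t) fun x _ => ?_).trans
    ((hC T v p h l j t ht').trans (mul_le_mul_of_nonneg_left ?_ hC0))
  · exact Finset.single_le_sum (f := fun i => D (i :: l) (v j) (t, x) ^ 2)
      (fun j _ => sq_nonneg _) (Finset.mem_univ i)
  · change ∫ x in ball (0 : E3) ρ, (D l (v j) (t, x) ^ 2 + ∑ i, vort v l i j (t, x) ^ 2) ≤ _
    have i0 : ∀ {f : ST → ℝ}, ContDiff ℝ ∞ f →
        IntegrableOn (fun x => f (t, x)) (ball (0 : E3) ρ) := fun hf =>
      integrableOn_ball (continuous_slice hf.continuous t) _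
    have s2 : ContDiff ℝ ∞ fun q => ∑ i, vort v l i j q ^ 2 := by fun_prop
    rw [integral_add (i0 (hD0.pow 2)) (i0 s2),
      integral_finsetSum _ fun i _ => i0 ((hw i).pow 2)]
    have s1 := Finset.sum_le_sum fun m (_ : m ∈ (Finset.univ : Finset (Fin 3))) =>
      (hB T v p h l hl' m j).1 t ht'
    simp only [Finset.sum_const, Finset.card_univ, Fintype.card_fin, nsmul_eq_mul,
      Nat.cast_ofNat] at s1
    linarith [hA T v p h l hl' j t ht']

lemma cylBound_succ {R : ℝ} {k : ℕ} (hS : ∀ j ≤ k, SliceBound R j)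
    (hB : ∀ j ≤ k + 1, CylBound R j) : CylBound R (k + 2) := by
  intro r hr hrR
  have hrr : r < (r + R) / 2 := by linarith
  have hrr' : (r + R) / 2 < R := by linarith
  obtain ⟨C, hC0, hC⟩ := div_curl hr hrr hrr'
  obtain ⟨A, hA0, hA⟩ := hB (k + 1) le_rfl _ (by linarith) hrr'
  obtain ⟨B, hB0, hB⟩ := vort_bound hS hB _ (by linarith) hrr'
  refine ⟨C * (A + 3 * B), by positivity, fun T v p h l hl j => ?_⟩
  obtain ⟨i, l, rfl⟩ := List.exists_cons_of_length_eq_add_one hl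
  obtain ⟨m, l, rfl⟩ := List.exists_cons_of_length_eq_add_one
    (show l.length = k + 1 by simpa using hl)
  have hl' : l.length = k := by simpa using hl
  have hv := h.smooth
  set ρ := (r + R) / 2
  have hD := fun i => smooth_D (i :: m :: l) (hv j)
  have hD0 := smooth_D (m :: l) (hv j)
  have hw := fun m i => smooth_vort hv (m :: l) i j
  have s1 : ContDiff ℝ ∞ fun q => ∑ i, D (i :: m :: l) (v j) q ^ 2 := by fun_prop
  have s2 : ContDiff ℝ ∞ fun q => D (m :: l) (v j) q ^ 2 + ∑ i, vort v (m :: l) i j q ^ 2 := by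
    have := hw m
    fun_prop
  have hcyl := integral_cyl_le_of_slice s1.continuous s2.continuous (fun q => by
    have : 0 ≤ ∑ i, vort v (m :: l) i j q ^ 2 := Finset.sum_nonneg fun i _ => sq_nonneg _
    positivity) hr.le hrr.le hC0
    fun t ht => hC T v p h (m :: l) j t (Icc_subset_of_lt hr hrr ht)
  refine (integral_cyl_mono ((hD i).pow 2).continuous s1.continuous fun q _ => ?_).trans
    (hcyl.trans (mul_le_mul_of_nonneg_left ?_ hC0))
  · exact Finset.single_le_sum (f := fun i => D (i :: m :: l) (v j) q ^ 2)
      (fun j _ => sq_nonneg _) (Finset.mem_univ i)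
  · have i0 : ∀ {f : ST → ℝ}, ContDiff ℝ ∞ f → IntegrableOn f (cyl (-ρ ^ 2) T ρ) := fun hf =>
      integrableOn_cyl hf.continuous _ _ _
    have hw' := hw m
    rw [integral_add (i0 (hD0.pow 2)) (i0 (by fun_prop)),
      integral_finsetSum _ fun i _ => i0 ((hw m i).pow 2)]
    have s3 : ∀ i, ∫ q in cyl (-ρ ^ 2) T ρ, vort v (m :: l) i j q ^ 2 ≤ B := fun i => by
      have s4 : ContDiff ℝ ∞ fun q => ∑ m, vort v (m :: l) i j q ^ 2 :=
        ContDiff.sum fun m _ => (hw m i).pow 2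
      refine (integral_cyl_mono ((hw m i).pow 2).continuous s4.continuous fun q _ => ?_).trans
        (hB T v p h l hl' i j).2
      exact Finset.single_le_sum (f := fun m => vort v (m :: l) i j q ^ 2)
        (fun j _ => sq_nonneg _) (Finset.mem_univ m)
    have s5 := Finset.sum_le_sum fun i (_ : i ∈ (Finset.univ : Finset (Fin 3))) => s3 i
    simp only [Finset.sum_const, Finset.card_univ, Fintype.card_fin, nsmul_eq_mul,
      Nat.cast_ofNat] at s5
    linarith [hA T v p h (m :: l) (by simp [hl']) j]

lemma all_bounds {R : ℝ} (hR : 0 < R) (k : ℕ) :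
    (∀ j ≤ k, SliceBound R j) ∧ ∀ j ≤ k + 1, CylBound R j := by
  induction k with
  | zero =>
    refine ⟨fun j hj => ?_, fun j hj => ?_⟩
    · obtain rfl : j = 0 := by omega
      exact sliceBound_zero R
    · rcases (by omega : j = 0 ∨ j = 1) with rfl | rfl
      · exact cylBound_zero R
      · exact cylBound_one hR
  | succ k ih =>
    refine ⟨fun j hj => ?_, fun j hj => ?_⟩
    · rcases Nat.le_succ_iff.1 hj with h | rfl
      · exact ih.1 j h
      · exact sliceBound_succ ih.1 ih.2
    · rcases Nat.le_succ_iff.1 hj with h | rfl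
      · exact ih.2 j h
      · exact cylBound_succ ih.1 ih.2

/-- Interior pointwise bounds for all spatial derivatives of the velocity. -/
lemma pointwise_bound {r R : ℝ} (hr : 0 < r) (hrR : r < R) (n : ℕ) : ∃ C : ℝ, 0 ≤ C ∧
    ∀ T v p, Adm R T v p → ∀ l : List (Fin 3), l.length = n → ∀ i, ∀ t ∈ Icc (-r ^ 2) T,
      ∀ x ∈ ball (0 : E3) r, |D l (v i) (t, x)| ≤ C := by
  have hrr : r < (r + R) / 2 := by linarith
  have hrr' : (r + R) / 2 < R := by linarith
  have hS := (all_bounds (hr.trans hrR) (n + 2)).1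
  obtain ⟨C, hC0, hC⟩ := sobolev hr hrr
  obtain ⟨A0, hA0', hA0⟩ := hS n (by omega) _ (by linarith) hrr'
  obtain ⟨A1, hA1', hA1⟩ := hS (n + 1) (by omega) _ (by linarith) hrr'
  obtain ⟨A2, hA2', hA2⟩ := hS (n + 2) (by omega) _ (by linarith) hrr'
  refine ⟨Real.sqrt (C * (A0 + 3 * A1 + 3 * A2)), Real.sqrt_nonneg _,
    fun T v p h l hl i t ht x hx => ?_⟩
  have ht' := Icc_subset_of_lt hr hrr ht
  refine Real.abs_le_sqrt ((hC _ (smooth_D l (h.smooth i)) t x hx).trans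
    (mul_le_mul_of_nonneg_left ?_ hC0))
  have hf := smooth_D l (h.smooth i)
  have hf1 := fun i => smooth_dd hf (e i)
  have hf2 := fun i => smooth_dd (hf1 i) (e i)
  have i0 : ∀ {f : ST → ℝ}, ContDiff ℝ ∞ f →
      IntegrableOn (fun x => f (t, x)) (ball (0 : E3) ((r + R) / 2)) := fun hf =>
    integrableOn_ball (continuous_slice hf.continuous t) _
  have t1 : ContDiff ℝ ∞ fun q => ∑ j, dd (e j) (D l (v i)) q ^ 2 := by fun_prop
  have t2 : ContDiff ℝ ∞ fun q => ∑ j, dd (e j) (dd (e j) (D l (v i))) q ^ 2 := by fun_prop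
  rw [integral_add (i0 ((hf.pow 2).add t1)) (i0 t2), integral_add (i0 (hf.pow 2)) (i0 t1),
    integral_finsetSum _ fun j _ => i0 ((hf1 j).pow 2),
    integral_finsetSum _ fun j _ => i0 ((hf2 j).pow 2)]
  have s1 := Finset.sum_le_sum fun j (_ : j ∈ (Finset.univ : Finset (Fin 3))) =>
    hA1 T v p h (j :: l) (by simp [hl]) i t ht'
  have s2 := Finset.sum_le_sum fun j (_ : j ∈ (Finset.univ : Finset (Fin 3))) =>
    hA2 T v p h (j :: j :: l) (by simp [hl]) i t ht'
  simp only [D_cons _ (h.smooth i), Finset.sum_const, Finset.card_univ, Fintype.card_fin,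
    nsmul_eq_mul, Nat.cast_ofNat] at s1 s2
  have s0 := hA0 T v p h l hl i t ht'
  linarith

lemma norm_iteratedFDeriv_sum_smul_le {Y : Type*} [NormedAddCommGroup Y] [NormedSpace ℝ Y] (n : ℕ)
    {f : Fin 3 → E3 → ℝ} (hf : ∀ i, ContDiff ℝ ∞ (f i)) {b : Fin 3 → Y} (hb : ∀ i, ‖b i‖ ≤ 1)
    {C : ℝ} {x : E3} (h : ∀ i, ‖iteratedFDeriv ℝ n (f i) x‖ ≤ C) :
    ‖iteratedFDeriv ℝ n (fun y => ∑ i, f i y • b i) x‖ ≤ 3 * C := by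
  have hn : ∀ i, ContDiffAt ℝ n (f i) x := fun i =>
    (hf i).contDiffAt.of_le (mod_cast le_top)
  have h1 : ∀ i, ‖iteratedFDeriv ℝ n (fun y => f i y • b i) x‖ ≤ C := fun i => by
    have h2 := (ContinuousLinearMap.toSpanSingleton ℝ (b i)).norm_iteratedFDeriv_comp_left
      (hn i) le_rfl
    rw [ContinuousLinearMap.norm_toSpanSingleton] at h2
    refine h2.trans ?_
    have := mul_le_mul (hb i) (h i) (norm_nonneg _) zero_le_one
    linarith
  rw [iteratedFDeriv_fun_sum_apply (f := fun i y => f i y • b i)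
    fun i _ => (hn i).smul contDiffAt_const]
  refine (norm_sum_le _ _).trans ((Finset.sum_le_sum fun i _ => h1 i).trans ?_)
  simp

lemma norm_iteratedFDeriv_slice_le (n : ℕ) {f : ST → ℝ} (hf : ContDiff ℝ ∞ f) {C t : ℝ} {x : E3}
    (h : ∀ l : List (Fin 3), l.length = n → |D l f (t, x)| ≤ C) :
    ‖iteratedFDeriv ℝ n (fun y : E3 => f (t, y)) x‖ ≤ 3 ^ n * C := by
  induction n generalizing f with
  | zero => simpa [D] using h [] rfl
  | succ n ih =>
    have hs : ∀ {f : ST → ℝ}, ContDiff ℝ ∞ f → ContDiff ℝ ∞ fun y : E3 => f (t, y) := fun hf =>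
      hf.comp (contDiff_const.prodMk contDiff_id)
    have h1 : fderiv ℝ (fun y : E3 => f (t, y)) = fun y => ∑ j, dd (e j) f (t, y) •
        (EuclideanSpace.proj j : E3 →L[ℝ] ℝ) := by
      ext y w
      rw [← (EuclideanSpace.basisFun (Fin 3) ℝ).sum_repr w]
      simp only [map_sum, map_smul, EuclideanSpace.basisFun_apply, EuclideanSpace.basisFun_repr,
        ← dd_slice hf]
      simp [dd, Fin.sum_univ_three]
    rw [← norm_iteratedFDeriv_fderiv, h1, pow_succ', mul_assoc]
    refine norm_iteratedFDeriv_sum_smul_le n (fun j => hs (smooth_dd hf (e j)))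
      (fun j => ContinuousLinearMap.opNorm_le_bound _ zero_le_one fun w => ?_)
      fun j => ih (smooth_dd hf (e j)) fun l hl => h (j :: l) (by simp [hl])
    rw [one_mul]
    exact PiLp.norm_apply_le w j

lemma exists_smooth_extension {K U : Set ST} (hK : IsClosed K) (hU : IsOpen U) (hKU : K ⊆ U) :
    ∃ χ : ST → ℝ, (∀ q ∈ K, ∀ᶠ q' in nhds q, χ q' = 1) ∧
      ∀ G : ST → ℝ, ContDiffOn ℝ ∞ G U → ContDiff ℝ ∞ fun q => χ q * G q := by
  obtain ⟨χ, h0, h1, -⟩ := exists_contMDiffMap_zero_one_nhds_of_isClosed (n := (⊤ : ℕ∞))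
    (modelWithCornersSelf ℝ ST) hU.isClosed_compl hK (disjoint_compl_left_iff_subset.2 hKU)
  refine ⟨χ, fun q hq => h1.filter_mono (nhds_le_nhdsSet hq), fun G hG => ?_⟩
  rw [contDiff_iff_contDiffAt]
  intro q
  by_cases hq : q ∈ U
  · exact χ.contMDiff.contDiff.contDiffAt.mul (hG.contDiffAt (hU.mem_nhds hq))
  · have : (fun q => χ q * G q) =ᶠ[nhds q] fun _ => 0 := by
      filter_upwards [h0.filter_mono (nhds_le_nhdsSet hq)] with q' hq'
      rw [hq', zero_mul]
    exact contDiffAt_const.congr_of_eventuallyEq this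

section Germ

variable {f : ST → ℝ} {g : ℝ → E3 → ℝ} {t : ℝ} {x : E3}

lemma eventually_slice_eq (h : ∀ᶠ q in nhds (t, x), f q = g q.1 q.2) :
    ∀ᶠ y in nhds x, f (t, y) = g t y :=
  (Continuous.prodMk_right t).continuousAt.eventually h

lemma pd_eq_dd (hf : ContDiff ℝ ∞ f) (h : ∀ᶠ q in nhds (t, x), f q = g q.1 q.2) (j : Fin 3) :
    pd (g t) j x = dd (e j) f (t, x) := by
  have h1 : (fun y => f (t, y)) =ᶠ[nhds x] g t := eventually_slice_eq h
  rw [← dd_slice hf, dd, h1.fderiv_eq]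
  rfl

lemma pd_pd_eq_dd_dd (hf : ContDiff ℝ ∞ f) (h : ∀ᶠ q in nhds (t, x), f q = g q.1 q.2)
    (j : Fin 3) : pd (pd (g t) j) j x = dd (e j) (dd (e j) f) (t, x) :=
  pd_eq_dd (g := fun s => pd (g s) j) (smooth_dd hf (e j))
    (h.eventually_nhds.mono fun _ hq => (pd_eq_dd hf hq j).symm) j

lemma deriv_eq_dd (hf : ContDiff ℝ ∞ f) (h : ∀ᶠ q in nhds (t, x), f q = g q.1 q.2) :
    deriv (fun s => g s x) t = dd tt f (t, x) := by
  have h1 : (fun s => f (s, x)) =ᶠ[nhds t] fun s => g s x :=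
    (Continuous.prodMk_left x).continuousAt.eventually h
  rw [← h1.deriv_eq, (hasDerivAt_time hf t x).deriv]

end Germ

lemma abs_pd_le (f : E3 → ℝ) (j : Fin 3) (x : E3) : |pd f j x| ≤ ‖fderiv ℝ f x‖ := by
  simpa [pd] using (fderiv ℝ f x).le_opNorm (EuclideanSpace.single j 1)

lemma integral_cyl_abs_le {f : ST → ℝ} (hf : Continuous f) {a b r : ℝ} {g : ℝ → E3 → ℝ≥0∞}
    (hfg : ∀ t ∈ Icc a b, ∀ x ∈ ball (0 : E3) r, ENNReal.ofReal |f (t, x)| ≤ g t x)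
    {I : Set ℝ} (hI : Icc a b ⊆ I) {B : Set E3} (hB : ball 0 r ⊆ B)
    (hg : ∫⁻ t in I, ∫⁻ x in B, g t x ≤ 1) : ∫ q in cyl a b r, |f q| ≤ 1 := by
  rw [← ENNReal.ofReal_le_one, ofReal_integral_eq_lintegral_ofReal
    (integrableOn_cyl hf.abs a b r) (.of_forall fun _ => abs_nonneg _), Measure.volume_eq_prod,
    ← Measure.prod_restrict, lintegral_prod _ (by fun_prop)]
  refine le_trans ?_ hg
  exact (setLIntegral_mono' measurableSet_Icc fun t ht =>
    (setLIntegral_mono' measurableSet_ball fun x hx => hfg t ht x hx).trans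
      (lintegral_mono_set hB)).trans (lintegral_mono_set hI)

lemma exists_adm {u : ℝ → E3 → E3} {P : ℝ → E3 → ℝ}
    (hns : IsNSSolution u P (Ioo (-(1 : ℝ) / 4) 0 ×ˢ ball (0 : E3) (1 / 2)))
    (hu : ∀ t ∈ Ioo (-(1 : ℝ) / 4) 0, ∀ x ∈ ball (0 : E3) (1 / 2), ‖u t x‖ ≤ 1)
    (hP : (∫⁻ t in Ioo (-(1 : ℝ) / 4) 0, ∫⁻ x in ball (0 : E3) (1 / 2),
      ENNReal.ofReal ‖fderiv ℝ (P t) x‖) ≤ 1)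
    {R T : ℝ} (hR0 : 0 < R) (hR : R < 1 / 2) (hT : T < 0) :
    ∃ v p, Adm R T v p ∧ ∀ t ∈ Icc (-R ^ 2) T, ∀ x ∈ ball (0 : E3) R, ∀ i,
      ∀ᶠ q in nhds (t, x), v i q = u q.1 q.2 i := by
  obtain ⟨hsu, hsP, heq, hdiv⟩ := hns
  have hI : Icc (-R ^ 2) T ⊆ Ioo (-(1 : ℝ) / 4) 0 := fun t ht =>
    ⟨by nlinarith [ht.1], ht.2.trans_lt hT⟩
  have hB : closedBall (0 : E3) R ⊆ ball 0 (1 / 2) := closedBall_subset_ball hR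
  obtain ⟨χ, h1, hχ⟩ := exists_smooth_extension (isClosed_Icc.prod isClosed_closedBall)
    (isOpen_Ioo.prod isOpen_ball) (prod_mono hI hB)
  have hv : ∀ i, ContDiff ℝ ∞ fun q : ST => χ q * u q.1 q.2 i := fun i =>
    hχ _ ((EuclideanSpace.proj i : E3 →L[ℝ] ℝ).contDiff.comp_contDiffOn hsu)
  have hp : ContDiff ℝ ∞ fun q : ST => χ q * P q.1 q.2 := hχ _ hsP
  have hχ1 : ∀ t ∈ Icc (-R ^ 2) T, ∀ x ∈ ball (0 : E3) R, ∀ᶠ q in nhds (t, x), χ q = 1 :=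
    fun t ht x hx => h1 (t, x) ⟨ht, ball_subset_closedBall hx⟩
  have hgv : ∀ t ∈ Icc (-R ^ 2) T, ∀ x ∈ ball (0 : E3) R, ∀ i,
      ∀ᶠ q in nhds (t, x), χ q * u q.1 q.2 i = u q.1 q.2 i := fun t ht x hx i =>
    (hχ1 t ht x hx).mono fun q hq => by rw [hq, one_mul]
  have hgp : ∀ t ∈ Icc (-R ^ 2) T, ∀ x ∈ ball (0 : E3) R,
      ∀ᶠ q in nhds (t, x), χ q * P q.1 q.2 = P q.1 q.2 := fun t ht x hx =>
    (hχ1 t ht x hx).mono fun q hq => by rw [hq, one_mul]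
  have hm : ∀ t ∈ Icc (-R ^ 2) T, ∀ x ∈ ball (0 : E3) R,
      ((t, x) : ST) ∈ Ioo (-(1 : ℝ) / 4) 0 ×ˢ ball (0 : E3) (1 / 2) := fun t ht x hx =>
    ⟨hI ht, hB (ball_subset_closedBall hx)⟩
  refine ⟨fun i q => χ q * u q.1 q.2 i, fun q => χ q * P q.1 q.2,
    ⟨hT.le, hv, hp, fun t ht x hx i => ?_, fun t ht x hx => ?_, fun t ht x hx i => ?_,
      fun i => ?_⟩, hgv⟩
  · have h0 := heq _ (hm t ht x hx) i
    have hg := fun i => hgv t ht x hx i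
    simp only [pd_eq_dd (g := fun s y => u s y i) (hv i) (hg i),
      pd_pd_eq_dd_dd (g := fun s y => u s y i) (hv i) (hg i),
      deriv_eq_dd (g := fun s y => u s y i) (hv i) (hg i),
      pd_eq_dd (g := P) hp (hgp t ht x hx)] at h0
    simp only [(hg _).self_of_nhds]
    linarith
  · have h0 := hdiv _ (hm t ht x hx)
    have hg := fun i => hgv t ht x hx i
    rw [← h0]
    exact Finset.sum_congr rfl fun i _ =>
      (pd_eq_dd (g := fun s y => u s y i) (hv i) (hg i) i).symm
  · rw [(hgv t ht x hx i).self_of_nhds]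
    exact (PiLp.norm_apply_le (u t x) i).trans (hu t (hI ht) x (hm t ht x hx).2)
  · refine integral_cyl_abs_le (smooth_dd hp (e i)).continuous (fun t ht x hx => ?_) hI
      (ball_subset_closedBall.trans hB) hP
    rw [← pd_eq_dd (g := P) hp (hgp t ht x hx)]
    exact ENNReal.ofReal_le_ofReal (abs_pd_le _ _ _)

end NSBootstrap

/-- Bootstrap estimate: for each `n ≥ 1` there is `C_n` such that any smooth solution of
Navier–Stokes on `Q_{1/2} = (−1/4,0) × B_{1/2}` with `|u| ≤ 1` on `Q_{1/2}` and
`∫∫_{Q_{1/2}} |∇P| ≤ 1` satisfies `|∇ⁿu| ≤ C_n` on `Q_{1/4}`. -/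
theorem ns_bootstrap (n : ℕ) (hn : 1 ≤ n) :
    ∃ C > (0:ℝ), ∀ (u : ℝ → E3 → E3) (P : ℝ → E3 → ℝ),
      IsNSSolution u P (Set.Ioo (-(1:ℝ)/4) 0 ×ˢ ball (0:E3) (1/2)) →
      (∀ t ∈ Set.Ioo (-(1:ℝ)/4) 0, ∀ x ∈ ball (0:E3) (1/2), ‖u t x‖ ≤ 1) →
      (∫⁻ t in Set.Ioo (-(1:ℝ)/4) 0, ∫⁻ x in ball (0:E3) (1/2),
          ENNReal.ofReal ‖fderiv ℝ (P t) x‖) ≤ 1 →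
      ∀ t ∈ Set.Ioo (-(1:ℝ)/16) 0, ∀ x ∈ ball (0:E3) (1/4),
        ‖iteratedFDeriv ℝ n (u t) x‖ ≤ C := by
  obtain ⟨C, hC0, hC⟩ := NSBootstrap.pointwise_bound (r := 1 / 4) (R := 3 / 8)
    (by norm_num) (by norm_num) n
  refine ⟨3 * (3 ^ n * C) + 1, by positivity, fun u P hns hu hP t ht x hx => ?_⟩
  obtain ⟨v, p, hA, hvu⟩ := NSBootstrap.exists_adm hns hu hP (R := 3 / 8)
    (by norm_num) (by norm_num) ht.2
  have ht1 : t ∈ Icc (-(1 / 4 : ℝ) ^ 2) t := ⟨by linarith [ht.1], le_rfl⟩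
  have ht2 : t ∈ Icc (-(3 / 8 : ℝ) ^ 2) t := ⟨by linarith [ht.1], le_rfl⟩
  have hx2 : x ∈ ball (0 : E3) (3 / 8) := ball_subset_ball (by norm_num) hx
  have hs : u t =ᶠ[nhds x] fun y => ∑ i, v i (t, y) • EuclideanSpace.single i (1 : ℝ) := by
    filter_upwards [Filter.eventually_all.2 fun i =>
      NSBootstrap.eventually_slice_eq (g := fun s y => u s y i) (hvu t ht2 x hx2 i)] with y hy
    simp only [hy]
    simpa using ((EuclideanSpace.basisFun (Fin 3) ℝ).sum_repr (u t y)).symm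
  rw [(hs.iteratedFDeriv ℝ n).self_of_nhds]
  refine (NSBootstrap.norm_iteratedFDeriv_sum_smul_le n
    (fun i => (hA.smooth i).comp (contDiff_const.prodMk contDiff_id)) (fun i => by simp)
    fun i => NSBootstrap.norm_iteratedFDeriv_slice_le n (hA.smooth i)
      fun l hl => hC t v p hA l hl i t ht1 x hx).trans (by linarith)
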